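/- arXiv:2402.08144 — 6 statements merged into one kernel-verified Lean document; each statement's English description precedes it below -/
import Mathlib

section
/- Let p ∈ (0,1) and q = 1 − p. There exist a constant C > 0 and an integer N such that for every integer n > N, | √(2πnpq) · C(n, ⌊np⌋) · p^{⌊np⌋} · q^{n−⌊np⌋} − 1 | ≤ C/n; equivalently, C(n,⌊np⌋) p^{⌊np⌋} q^{n−⌊np⌋} = (1/√(2πnpq)) · (1 ± O(1/n)). -/
open Filter Topology in
/-- Robbins' upper bound for the Stirling sequence. -/
theorem log_stirlingSeq_le {n : ℕ} (hn : n ≠ 0) :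
    Real.log (Stirling.stirlingSeq n) ≤ Real.log Real.pi / 2 + 1 / (12 * n) := by
  obtain ⟨m, rfl⟩ := Nat.exists_eq_succ_of_ne_zero hn
  have hmono : Monotone fun i : ℕ =>
      Real.log (Stirling.stirlingSeq (i + 1)) - 1 / (12 * ((i : ℝ) + 1)) := by
    refine monotone_nat_of_le_succ fun i => ?_
    have h := Stirling.log_stirlingSeq_sdiff_le (i + 1)
    have e : (1 : ℝ) / (12 * ((i + 1 : ℕ) : ℝ) * (((i + 1 : ℕ) : ℝ) + 1)) =
        1 / (12 * ((i : ℝ) + 1)) - 1 / (12 * (((i + 1 : ℕ) : ℝ) + 1)) := by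
      push_cast
      field_simp
      ring
    rw [e] at h
    linarith
  have hlim : Tendsto (fun i : ℕ =>
      Real.log (Stirling.stirlingSeq (i + 1)) - 1 / (12 * ((i : ℝ) + 1))) atTop
      (𝓝 (Real.log (√Real.pi) - 1 / 12 * 0)) := by
    have h1 : Tendsto (fun i : ℕ => Real.log (Stirling.stirlingSeq (i + 1))) atTop
        (𝓝 (Real.log (√Real.pi))) :=
      (Stirling.tendsto_stirlingSeq_sqrt_pi.comp (tendsto_add_atTop_nat 1)).log
        (Real.sqrt_pos.2 Real.pi_pos).ne'
    refine (h1.sub (tendsto_one_div_add_atTop_nhds_zero_nat.const_mul (1 / 12 : ℝ))).congr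
      fun i => ?_
    field_simp
  have h := hmono.ge_of_tendsto hlim m
  rw [Real.log_sqrt Real.pi_pos.le] at h
  push_cast
  linarith

/-- The error `log n! - (n log n - n + log n / 2 + log (2π) / 2)` in Stirling's formula. -/
noncomputable def logStirlingError (n : ℕ) : ℝ :=
  Real.log (n.factorial : ℝ) -
    (n * Real.log n - n + Real.log n / 2 + Real.log (2 * Real.pi) / 2)

theorem logStirlingError_nonneg {n : ℕ} (hn : n ≠ 0) : 0 ≤ logStirlingError n :=
  sub_nonneg.2 (Stirling.le_log_factorial_stirling hn)

theorem logStirlingError_le {n : ℕ} (hn : n ≠ 0) : logStirlingError n ≤ 1 / (12 * n) := by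
  have h := log_stirlingSeq_le hn
  have hn' : (n : ℝ) ≠ 0 := Nat.cast_ne_zero.2 hn
  rw [Stirling.log_stirlingSeq_formula, Real.log_mul two_ne_zero hn',
    Real.log_div hn' (Real.exp_pos 1).ne', Real.log_exp] at h
  rw [logStirlingError, Real.log_mul two_ne_zero Real.pi_pos.ne']
  linarith

/-- Exact logarithm of the normalized binomial probability mass function. -/
theorem log_sqrt_mul_binomial {k l : ℕ} (hk : k ≠ 0) (hl : l ≠ 0) {p q : ℝ} (hp : 0 < p)
    (hq : 0 < q) :
    Real.log (√(2 * Real.pi * (k + l : ℕ) * p * q) * (((k + l).choose k : ℝ) * p ^ k * q ^ l)) =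
      logStirlingError (k + l) - logStirlingError k - logStirlingError l +
        (k + 1 / 2) * Real.log ((k + l : ℕ) * p / k) +
        (l + 1 / 2) * Real.log ((k + l : ℕ) * q / l) := by
  have hk' : (0 : ℝ) < k := by positivity
  have hl' : (0 : ℝ) < l := by positivity
  have hn : (0 : ℝ) < (k + l : ℕ) := by positivity
  have hpi := Real.pi_pos
  have hc : (0 : ℝ) < (k + l).choose k := Nat.cast_pos.2 (Nat.choose_pos (Nat.le_add_right k l))
  have hC : Real.log ((k + l).choose k : ℝ) = Real.log ((k + l).factorial : ℝ) -
      (Real.log (k.factorial : ℝ) + Real.log (l.factorial : ℝ)) := by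
    rw [Nat.cast_choose ℝ (Nat.le_add_right k l), Nat.add_sub_cancel_left,
      Real.log_div (by positivity) (by positivity), Real.log_mul (by positivity) (by positivity)]
  have hcast : ((k + l : ℕ) : ℝ) = k + l := Nat.cast_add k l
  rw [Real.log_mul (by positivity) (by positivity), Real.log_sqrt (by positivity),
    Real.log_mul (by positivity) hq.ne', Real.log_mul (by positivity) hp.ne',
    Real.log_mul (by positivity) hn.ne', Real.log_mul (by positivity) (by positivity),
    Real.log_mul (y := q ^ l) (by positivity) (by positivity),
    Real.log_mul (x := (((k + l).choose k : ℕ) : ℝ)) (by positivity) (by positivity),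
    Real.log_pow, Real.log_pow, hC,
    Real.log_div (by positivity) hk'.ne', Real.log_div (by positivity) hl'.ne',
    Real.log_mul hn.ne' hp.ne', Real.log_mul hn.ne' hq.ne']
  simp only [logStirlingError]
  rw [Real.log_mul two_ne_zero hpi.ne']
  generalize Real.log ((k + l : ℕ) : ℝ) = L
  rw [hcast]
  ring

/-- Two-sided bound for the entropy and square-root terms when `k` is the integer part of
`x = np` and `l = y + (x - k)`, with `y = nq`. -/
theorem abs_log_terms_le {k l x y θ : ℝ} (hk : 0 < k) (hy : 0 < y)
    (hkx : k = x - θ) (hly : l = y + θ) (hθ : 0 ≤ θ) (hθ1 : θ ≤ 1) :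
    (k + 1 / 2) * Real.log (x / k) + (l + 1 / 2) * Real.log (y / l) ≤ 1 / (2 * k) ∧
      -(1 / x + 3 / (2 * y)) ≤
        (k + 1 / 2) * Real.log (x / k) + (l + 1 / 2) * Real.log (y / l) := by
  have hx : 0 < x := by linarith
  have hl : 0 < l := by linarith
  have u1 := Real.log_le_sub_one_of_pos (div_pos hx hk)
  have u2 := Real.log_le_sub_one_of_pos (div_pos hy hl)
  have l1 := Real.one_sub_inv_le_log_of_pos (div_pos hx hk)
  have l2 := Real.one_sub_inv_le_log_of_pos (div_pos hy hl)
  rw [inv_div] at l1 l2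
  have hθ2 : θ ^ 2 ≤ 1 := pow_le_one₀ hθ hθ1
  constructor
  · have e : (k + 1 / 2) * (x / k - 1) + (l + 1 / 2) * (y / l - 1) =
        θ / (2 * k) - θ / (2 * l) := by
      rw [show x = k + θ by linarith, show y = l - θ by linarith]
      field_simp
      ring
    have b1 : θ / (2 * k) ≤ 1 / (2 * k) := by gcongr
    have b2 : 0 ≤ θ / (2 * l) := by positivity
    have := mul_le_mul_of_nonneg_left u1 (by positivity : 0 ≤ k + 1 / 2)
    have := mul_le_mul_of_nonneg_left u2 (by positivity : 0 ≤ l + 1 / 2)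
    linarith
  · have e : (k + 1 / 2) * (1 - k / x) + (l + 1 / 2) * (1 - l / y) =
        -(θ ^ 2 / x + θ ^ 2 / y) + θ / (2 * x) - θ / (2 * y) := by
      rw [hkx, hly]
      field_simp
      ring
    have b1 : θ / (2 * y) ≤ 1 / (2 * y) := by gcongr
    have b2 : 0 ≤ θ / (2 * x) := by positivity
    have b3 : θ ^ 2 / x ≤ 1 / x := by gcongr
    have b4 : θ ^ 2 / y ≤ 1 / y := by gcongr
    have e2 : 3 / (2 * y) = 1 / y + 1 / (2 * y) := by
      field_simp
      norm_num
    have := mul_le_mul_of_nonneg_left l1 (by positivity : 0 ≤ k + 1 / 2)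
    have := mul_le_mul_of_nonneg_left l2 (by positivity : 0 ≤ l + 1 / 2)
    linarith

/-- Local Stirling estimate for the binomial pmf at `⌊np⌋`:
`C(n,⌊np⌋) p^⌊np⌋ q^(n-⌊np⌋) = (1/√(2πnpq)) (1 ± O(1/n))`. -/
theorem stirling_binom_at_floor_np (p : ℝ) (hp : 0 < p) (hp1 : p < 1) :
    ∃ C : ℝ, 0 < C ∧ ∃ N : ℕ, ∀ n : ℕ, N < n →
      |Real.sqrt (2 * Real.pi * n * p * (1 - p)) *
          ((n.choose ⌊(n : ℝ) * p⌋₊ : ℝ) * p ^ ⌊(n : ℝ) * p⌋₊ *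
            (1 - p) ^ (n - ⌊(n : ℝ) * p⌋₊)) - 1| ≤ C / n := by
  obtain ⟨q, hq⟩ : ∃ q, q = 1 - p := ⟨_, rfl⟩
  have hq0 : 0 < q := by linarith
  rw [← hq]
  refine ⟨6 / (p * q), by positivity, ⌈3 / (p * q)⌉₊, fun n hn => ?_⟩
  have hn3 : 3 / (p * q) < n := (Nat.le_ceil _).trans_lt (Nat.cast_lt.2 hn)
  have hn0 : (0 : ℝ) < n := lt_trans (by positivity) hn3
  have hnpq : 3 < n * (p * q) := (div_lt_iff₀ (by positivity)).1 hn3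
  have hpq : n * (p * q) ≤ n * p := by
    gcongr
    exact mul_le_of_le_one_right hp.le (by linarith)
  have hqp : n * (p * q) ≤ n * q := by
    gcongr
    exact mul_le_of_le_one_left hq0.le hp1.le
  have hpqn : n * (p * q) ≤ n := hpq.trans (mul_le_of_le_one_right hn0.le hp1.le)
  have hfl := Nat.floor_le (by positivity : 0 ≤ (n : ℝ) * p)
  have hlt := Nat.lt_floor_add_one ((n : ℝ) * p)
  generalize ⌊(n : ℝ) * p⌋₊ = k at hfl hlt ⊢
  have hkn : k ≤ n := by
    have : (k : ℝ) ≤ n := hfl.trans (mul_le_of_le_one_right hn0.le hp1.le)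
    exact_mod_cast this
  obtain ⟨l, rfl⟩ := Nat.exists_eq_add_of_le hkn
  rw [Nat.add_sub_cancel_left]
  have hcast : ((k + l : ℕ) : ℝ) = k + l := Nat.cast_add k l
  set n : ℕ := k + l with hn_def
  have hsum : (n : ℝ) * p + n * q = k + l := by rw [← hcast, hq]; ring
  have hk0 : (0 : ℝ) < k := by linarith
  have hl0 : (0 : ℝ) < l := by linarith
  have hk : k ≠ 0 := (Nat.cast_pos.1 hk0).ne'
  have hl : l ≠ 0 := (Nat.cast_pos.1 hl0).ne'
  have hn_ne : n ≠ 0 := (Nat.cast_pos.1 hn0).ne'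
  have hlog := log_sqrt_mul_binomial hk hl hp hq0
  obtain ⟨hU, hL⟩ := abs_log_terms_le (k := k) (l := l) (x := n * p) (y := n * q)
    (θ := n * p - k) hk0 (by positivity) (by ring) (by linarith) (by linarith) (by linarith)
  rw [← hn_def] at hlog
  have hpos : 0 < √(2 * Real.pi * n * p * q) * ((n.choose k : ℝ) * p ^ k * q ^ l) := by
    have hc : (0 : ℝ) < n.choose k := Nat.cast_pos.2 (Nat.choose_pos hkn)
    have := Real.pi_pos
    positivity
  have hD0 : 0 < (n : ℝ) * (p * q) := by positivity
  have bx : 1 / (n * p : ℝ) ≤ 1 / (n * (p * q)) := one_div_le_one_div_of_le hD0 hpq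
  have b_y : 1 / (n * q : ℝ) ≤ 1 / (n * (p * q)) := one_div_le_one_div_of_le hD0 hqp
  have bn : 1 / (n : ℝ) ≤ 1 / (n * (p * q)) := one_div_le_one_div_of_le hD0 hpqn
  have bl : 1 / (l : ℝ) ≤ 1 / (n * (p * q)) := one_div_le_one_div_of_le hD0 (by linarith)
  have bk : 1 / (2 * k : ℝ) ≤ 1 / (n * (p * q)) := one_div_le_one_div_of_le hD0 (by linarith)
  have hen := logStirlingError_le hn_ne
  have hek := logStirlingError_le hk
  have hel := logStirlingError_le hl
  have hen0 := logStirlingError_nonneg hn_ne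
  have hek0 := logStirlingError_nonneg hk
  have hel0 := logStirlingError_nonneg hl
  have e1 : 1 / (12 * n : ℝ) = 1 / 12 * (1 / n) := by field_simp
  have e2 : 1 / (12 * k : ℝ) = 1 / 6 * (1 / (2 * k)) := by field_simp; norm_num
  have e3 : 1 / (12 * l : ℝ) = 1 / 12 * (1 / l) := by field_simp
  have e4 : 3 / (2 * (n * q) : ℝ) = 3 / 2 * (1 / (n * q)) := by field_simp
  have hDpos : 0 < 1 / ((n : ℝ) * (p * q)) := by positivity
  have habs : |Real.log (√(2 * Real.pi * n * p * q) * ((n.choose k : ℝ) * p ^ k * q ^ l))| ≤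
      3 * (1 / (n * (p * q))) := by
    rw [hlog, abs_le]
    constructor <;> linarith
  have hone : 3 * (1 / (n * (p * q) : ℝ)) ≤ 1 := by
    rw [mul_one_div]
    exact (div_le_one hD0).2 hnpq.le
  have hexp := Real.abs_exp_sub_one_le (habs.trans hone)
  rw [Real.exp_log hpos] at hexp
  refine hexp.trans ((mul_le_mul_of_nonneg_left habs zero_le_two).trans_eq ?_)
  field_simp
  norm_num
end

section
/- Let p ∈ (0,1) and q = 1 − p. Then lim_{n→∞} Σ_{k=0}^{n} ( |k − np| / √(npq) ) · C(n,k) · p^{k} · q^{n−k} = 2/√(2π) = √(2/π); in particular this normalized mean absolute deviation of the binomial distribution is Θ(1). -/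
/-- Telescoping form of the centred binomial weights, the source of De Moivre's identity. -/
lemma sub_mul_binomial_eq_sub (p : ℝ) {n k : ℕ} (hk : k ≤ n) :
    ((k : ℝ) - n * p) * ((n.choose k : ℝ) * p ^ k * (1 - p) ^ (n - k)) =
      (1 - p) * k * ((n.choose k : ℝ) * p ^ k * (1 - p) ^ (n - k)) -
      (1 - p) * (k + 1 : ℕ) *
        ((n.choose (k + 1) : ℝ) * p ^ (k + 1) * (1 - p) ^ (n - (k + 1))) := by
  obtain ⟨j, rfl⟩ := Nat.exists_eq_add_of_le hk
  have h : ((k + j).choose (k + 1) : ℝ) * (k + 1) = (k + j).choose k * j := by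
    have := Nat.choose_succ_right_eq (k + j) k
    rw [Nat.add_sub_cancel_left] at this
    exact_mod_cast this
  rcases j with _ | j
  · simp only [Nat.add_zero, Nat.choose_succ_self, Nat.choose_self, Nat.sub_self]
    push_cast
    ring
  · have e1 : k + (j + 1) - k = j + 1 := by omega
    have e2 : k + (j + 1) - (k + 1) = j := by omega
    rw [e1, e2]
    push_cast at h ⊢
    linear_combination (1 - p) * p ^ (k + 1) * (1 - p) ^ j * h

/-- De Moivre's identity for the mean absolute deviation of the binomial distribution. -/
lemma sum_abs_sub_mul_binomial {p : ℝ} {n m : ℕ} (hmn : m ≤ n)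
    (h1 : n * p ≤ m) (h2 : (m : ℝ) ≤ n * p + 1) :
    ∑ k ∈ Finset.range (n + 1),
        |(k : ℝ) - n * p| * ((n.choose k : ℝ) * p ^ k * (1 - p) ^ (n - k)) =
      2 * ((1 - p) * m * ((n.choose m : ℝ) * p ^ m * (1 - p) ^ (n - m))) := by
  set G : ℕ → ℝ := fun k => (1 - p) * k * ((n.choose k : ℝ) * p ^ k * (1 - p) ^ (n - k)) with hG
  have hG0 : G 0 = 0 := by simp [hG]
  have hGn : G (n + 1) = 0 := by simp [hG]
  rw [← Finset.sum_range_add_sum_Ico _ (show m ≤ n + 1 by omega)]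
  have hlow : ∑ k ∈ Finset.range m,
      |(k : ℝ) - n * p| * ((n.choose k : ℝ) * p ^ k * (1 - p) ^ (n - k)) = G m := by
    rw [← sub_zero (G m), ← hG0, ← Finset.sum_range_sub]
    refine Finset.sum_congr rfl fun k hk => ?_
    rw [Finset.mem_range] at hk
    have hk' : (k : ℝ) + 1 ≤ m := by exact_mod_cast hk
    rw [abs_of_nonpos (by linarith), neg_mul, sub_mul_binomial_eq_sub p (by omega)]
    simp only [hG]
    ring
  have hhigh : ∑ k ∈ Finset.Ico m (n + 1),
      |(k : ℝ) - n * p| * ((n.choose k : ℝ) * p ^ k * (1 - p) ^ (n - k)) = G m := by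
    have := Finset.sum_Ico_sub G (show m ≤ n + 1 by omega)
    rw [hGn, zero_sub] at this
    rw [← neg_neg (G m), ← this, ← Finset.sum_neg_distrib]
    refine Finset.sum_congr rfl fun k hk => ?_
    rw [Finset.mem_Ico] at hk
    have hk' : (m : ℝ) ≤ k := by exact_mod_cast hk.1
    rw [abs_of_nonneg (by linarith), sub_mul_binomial_eq_sub p (by omega)]
    simp only [hG]
    ring
  rw [hlow, hhigh]
  ring

/-- The binomial weights in terms of Stirling's sequence. -/
lemma binomial_eq_stirlingSeq (p q : ℝ) {m j : ℕ} (hm : 0 < m) (hj : 0 < j) :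
    ((m + j).choose m : ℝ) * p ^ m * q ^ j =
      Stirling.stirlingSeq (m + j) / (Stirling.stirlingSeq m * Stirling.stirlingSeq j) *
        √(((m : ℝ) + j) / (2 * m * j)) *
        ((((m : ℝ) + j) * p / m) ^ m * (((m : ℝ) + j) * q / j) ^ j) := by
  have hm' : (0 : ℝ) < m := by exact_mod_cast hm
  have hj' : (0 : ℝ) < j := by exact_mod_cast hj
  have hs : √(((m : ℝ) + j) / (2 * m * j)) = √(2 * ((m : ℝ) + j)) / (√(2 * m) * √(2 * j)) := by
    rw [← Real.sqrt_mul (by positivity), ← Real.sqrt_div (by positivity)]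
    congr 1
    field_simp
  have h1 : √(2 * (m : ℝ)) ≠ 0 := by positivity
  have h2 : √(2 * (j : ℝ)) ≠ 0 := by positivity
  have h3 : √(2 * ((m : ℝ) + j)) ≠ 0 := by positivity
  have h4 : (m.factorial : ℝ) ≠ 0 := by positivity
  have h5 : (j.factorial : ℝ) ≠ 0 := by positivity
  have h6 : (m : ℝ) + j ≠ 0 := by positivity
  rw [hs, Nat.cast_add_choose]
  simp only [Stirling.stirlingSeq, Nat.cast_add, div_pow, mul_pow, pow_add]
  field_simp

/-- The exponential factor of the local limit theorem near the mean is close to one. -/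
lemma exp_neg_le_pow_mul_pow {p : ℝ} (hp : 0 < p) (hp1 : p < 1) {m j : ℕ} (hm : 0 < m)
    (hj : 0 < j) (h1 : ((m : ℝ) + j) * p ≤ m) (h2 : (m : ℝ) ≤ (m + j) * p + 1) :
    Real.exp (-(1 / (((m : ℝ) + j) * p * (1 - p)))) ≤
        (((m : ℝ) + j) * p / m) ^ m * (((m : ℝ) + j) * (1 - p) / j) ^ j ∧
      (((m : ℝ) + j) * p / m) ^ m * (((m : ℝ) + j) * (1 - p) / j) ^ j ≤ 1 := by
  have hm' : (0 : ℝ) < m := by exact_mod_cast hm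
  have hj' : (0 : ℝ) < j := by exact_mod_cast hj
  have hq : 0 < 1 - p := by linarith
  set x := ((m : ℝ) + j) * p / m with hx
  set y := ((m : ℝ) + j) * (1 - p) / j with hy
  have hx0 : 0 < x := by positivity
  have hy0 : 0 < y := by positivity
  have hT : x ^ m * y ^ j = Real.exp (m * Real.log x + j * Real.log y) := by
    rw [Real.exp_add, Real.exp_nat_mul, Real.exp_nat_mul, Real.exp_log hx0, Real.exp_log hy0]
  have ux := mul_le_mul_of_nonneg_left (Real.log_le_sub_one_of_pos hx0) hm'.le
  have uy := mul_le_mul_of_nonneg_left (Real.log_le_sub_one_of_pos hy0) hj'.le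
  have lx := mul_le_mul_of_nonneg_left (Real.one_sub_inv_le_log_of_pos hx0) hm'.le
  have ly := mul_le_mul_of_nonneg_left (Real.one_sub_inv_le_log_of_pos hy0) hj'.le
  have eu : (m : ℝ) * (x - 1) + j * (y - 1) = 0 := by
    rw [hx, hy]
    field_simp
    ring
  have el : (m : ℝ) * (1 - x⁻¹) + j * (1 - y⁻¹) =
      -((m - (m + j) * p) ^ 2 / (((m : ℝ) + j) * p * (1 - p))) := by
    rw [hx, hy]
    field_simp
    ring
  have hd : ((m : ℝ) - (m + j) * p) ^ 2 / (((m : ℝ) + j) * p * (1 - p)) ≤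
      1 / (((m : ℝ) + j) * p * (1 - p)) := by
    gcongr
    nlinarith
  rw [hT]
  exact ⟨Real.exp_le_exp.2 (by linarith), Real.exp_le_one_iff.2 (by linarith)⟩

open Filter Topology in
/-- The normalized mean absolute deviation of the binomial distribution converges to
`√(2/π)`. -/
theorem binomial_mad_limit (p : ℝ) (hp : 0 < p) (hp1 : p < 1) :
    Filter.Tendsto
      (fun n : ℕ => ∑ k ∈ Finset.range (n + 1),
        |(k : ℝ) - n * p| / Real.sqrt (n * p * (1 - p)) *
          ((n.choose k : ℝ) * p ^ k * (1 - p) ^ (n - k)))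
      Filter.atTop (nhds (Real.sqrt (2 / Real.pi))) := by
  have hq : 0 < 1 - p := by linarith
  have hnat : Tendsto (fun n : ℕ => (n : ℝ)) atTop atTop := tendsto_natCast_atTop_atTop
  set m : ℕ → ℕ := fun n => ⌊(n : ℝ) * p⌋₊ + 1 with hm_def
  have hm1 : ∀ n : ℕ, (n : ℝ) * p ≤ m n := fun n => by
    simpa [hm_def] using (Nat.lt_floor_add_one ((n : ℝ) * p)).le
  have hm2 : ∀ n : ℕ, (m n : ℝ) ≤ n * p + 1 := fun n => by
    simpa [hm_def] using Nat.floor_le (show 0 ≤ (n : ℝ) * p by positivity)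
  have hlt : ∀ᶠ n : ℕ in atTop, m n < n := by
    filter_upwards [(hnat.atTop_mul_const hq).eventually_gt_atTop 1] with n hn
    have : (m n : ℝ) < n := by linarith [hm2 n]
    exact_mod_cast this
  have hmtop : Tendsto m atTop atTop :=
    tendsto_natCast_atTop_iff.1 (tendsto_atTop_mono hm1 (hnat.atTop_mul_const hp))
  have hjtop : Tendsto (fun n => n - m n) atTop atTop := by
    refine (tendsto_natCast_atTop_iff (R := ℝ)).1 (tendsto_atTop_mono' _ ?_
      (tendsto_atTop_add_const_right _ (-1) (hnat.atTop_mul_const hq)))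
    filter_upwards [hlt] with n hn
    rw [Nat.cast_sub hn.le]
    linarith [hm2 n]
  have hratio : Tendsto (fun n : ℕ => (m n : ℝ) / n) atTop (𝓝 p) := by
    have hu : Tendsto (fun n : ℕ => p + 1 / (n : ℝ)) atTop (𝓝 p) := by
      simpa using (tendsto_const_nhds (x := p)).add tendsto_one_div_atTop_nhds_zero_nat
    refine tendsto_of_tendsto_of_tendsto_of_le_of_le' tendsto_const_nhds hu ?_ ?_
    all_goals
      filter_upwards [eventually_gt_atTop 0] with n hn
      have hn' : (0 : ℝ) < n := by exact_mod_cast hn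
    · rw [le_div_iff₀ hn']
      linarith [hm1 n]
    · rw [div_le_iff₀ hn', add_mul, one_div_mul_cancel hn'.ne']
      linarith [hm2 n]
  have hexp : Tendsto (fun n : ℕ => Real.exp (-(1 / ((n : ℝ) * p * (1 - p))))) atTop (𝓝 1) := by
    have : Tendsto (fun n : ℕ => -(1 / ((n : ℝ) * p * (1 - p)))) atTop (𝓝 0) := by
      simpa using (tendsto_inv_atTop_zero.comp
        ((hnat.atTop_mul_const hp).atTop_mul_const hq)).neg
    simpa using this.rexp
  have hT : Tendsto (fun n : ℕ => ((n : ℝ) * p / m n) ^ m n *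
      ((n : ℝ) * (1 - p) / (n - m n : ℕ)) ^ (n - m n)) atTop (𝓝 1) := by
    refine tendsto_of_tendsto_of_tendsto_of_le_of_le' hexp tendsto_const_nhds ?_ ?_
    all_goals
      filter_upwards [hlt] with n hn
      have hcast : ((m n : ℝ) + (n - m n : ℕ)) = n := by
        rw [Nat.cast_sub hn.le]
        ring
      have := exp_neg_le_pow_mul_pow hp hp1 (Nat.succ_pos _ : 0 < m n) (Nat.sub_pos_of_lt hn)
        (by rw [hcast]; exact hm1 n) (by rw [hcast]; exact hm2 n)
      rw [hcast] at this
    · exact this.1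
    · exact this.2
  have hS := Stirling.tendsto_stirlingSeq_sqrt_pi
  have hpi : √Real.pi ≠ 0 := by positivity
  have hquot := hS.div ((hS.comp hmtop).mul (hS.comp hjtop)) (mul_ne_zero hpi hpi)
  have hsqrt : Tendsto (fun n : ℕ => √(2 * (1 - p) * ((m n : ℝ) / n) / (p * (1 - (m n : ℝ) / n))))
      atTop (𝓝 √(2 * (1 - p) * p / (p * (1 - p)))) :=
    ((hratio.const_mul _).div ((hratio.const_sub 1).const_mul p) (by positivity)).sqrt
  have hlim := (hquot.mul hsqrt).mul hT
  have hval : √Real.pi / (√Real.pi * √Real.pi) * √(2 * (1 - p) * p / (p * (1 - p))) * 1 =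
      √(2 / Real.pi) := by
    have : 2 * (1 - p) * p / (p * (1 - p)) = 2 := by field_simp
    rw [this, Real.sqrt_div (by norm_num)]
    field_simp
  rw [hval] at hlim
  refine hlim.congr' ?_
  filter_upwards [hlt] with n hn
  obtain ⟨j, hj⟩ := Nat.exists_eq_add_of_le hn.le
  have hnm : n - m n = j := by omega
  have hj0 : 0 < j := by omega
  have hm0 : 0 < m n := Nat.succ_pos _
  have hj' : (0 : ℝ) < j := by exact_mod_cast hj0
  have hm' : (0 : ℝ) < m n := by exact_mod_cast hm0
  have hncast : (n : ℝ) = m n + j := by exact_mod_cast hj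
  have hn' : (0 : ℝ) < n := by linarith
  have hsum := sum_abs_sub_mul_binomial hn.le (hm1 n) (hm2 n)
  have hb := binomial_eq_stirlingSeq p (1 - p) hm0 hj0
  rw [← hj, ← hncast] at hb
  simp only [div_mul_eq_mul_div, ← Finset.sum_div]
  have hroot : √(2 * (1 - p) * ((m n : ℝ) / n) / (p * (1 - (m n : ℝ) / n))) =
      2 * (1 - p) * m n * √((n : ℝ) / (2 * m n * j)) / √(n * p * (1 - p)) := by
    have hjn : (j : ℝ) = n - m n := by linarith
    have hne : (n : ℝ) - m n ≠ 0 := by rw [← hjn]; exact hj'.ne'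
    rw [← Real.sqrt_sq (show 0 ≤ 2 * (1 - p) * (m n : ℝ) by positivity),
      ← Real.sqrt_mul (by positivity), ← Real.sqrt_div (by positivity), hjn]
    congr 1
    field_simp
  rw [hsum, hnm, hb, hroot]
  simp only [Function.comp_apply, Pi.div_apply, hnm]
  ring
end

section
/- Let p ∈ (0, 2/3). There exist a constant C > 0 and an integer N such that for every integer n > N, | Σ_{k=0}^{n} ( (k − np) / √(np(1−p)) ) · ( C(n,k) · p^{k} · (1−p)^{n−k} )² | ≤ C/n. -/
/-- The binomial probability mass function, extended by zero to `k > n`. -/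
noncomputable def binomMass (p : ℝ) (n k : ℕ) : ℝ :=
  (n.choose k : ℝ) * p ^ k * (1 - p) ^ (n - k)

namespace binomMass

variable {p : ℝ}

lemma nonneg (hp : 0 ≤ p) (hp1 : p ≤ 1) (n k : ℕ) : 0 ≤ binomMass p n k := by
  have : 0 ≤ 1 - p := sub_nonneg.2 hp1
  unfold binomMass
  positivity

lemma eq_zero_of_lt {n k : ℕ} (h : n < k) : binomMass p n k = 0 := by
  simp [binomMass, Nat.choose_eq_zero_of_lt h]

lemma succ_zero (p : ℝ) (n : ℕ) :
    binomMass p (n + 1) 0 = (1 - p) * binomMass p n 0 := by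
  simp [binomMass, pow_succ']

lemma succ_succ (p : ℝ) (n k : ℕ) :
    binomMass p (n + 1) (k + 1) = p * binomMass p n k + (1 - p) * binomMass p n (k + 1) := by
  unfold binomMass
  rw [Nat.choose_succ_succ, Nat.add_sub_add_right]
  rcases lt_or_ge k n with h | h
  · obtain ⟨d, rfl⟩ := Nat.exists_eq_add_of_lt h
    rw [show k + d + 1 - k = d + 1 by omega, show k + d + 1 - (k + 1) = d by omega]
    push_cast
    ring
  · rw [Nat.choose_eq_zero_of_lt (Nat.lt_succ_of_le h)]
    push_cast
    ring

lemma succ_mul (p : ℝ) (n k : ℕ) :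
    ((k : ℝ) + 1) * binomMass p (n + 1) (k + 1) = ((n : ℝ) + 1) * p * binomMass p n k := by
  unfold binomMass
  rw [Nat.add_sub_add_right]
  have h : ((n : ℝ) + 1) * n.choose k = (n + 1).choose (k + 1) * ((k : ℝ) + 1) := by
    exact_mod_cast Nat.add_one_mul_choose_eq n k
  linear_combination -p ^ (k + 1) * (1 - p) ^ (n - k) * h

lemma sub_mean_mul_zero (p : ℝ) (n : ℕ) :
    (((0 : ℕ) : ℝ) - ((n + 1 : ℕ) : ℝ) * p) * binomMass p (n + 1) 0 =
      -(((n + 1 : ℕ) : ℝ) * p * (1 - p) * binomMass p n 0) := by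
  rw [succ_zero]
  push_cast
  ring

lemma sub_mean_mul_succ (p : ℝ) (n k : ℕ) :
    (((k + 1 : ℕ) : ℝ) - ((n + 1 : ℕ) : ℝ) * p) * binomMass p (n + 1) (k + 1) =
      ((n + 1 : ℕ) : ℝ) * p * (1 - p) * (binomMass p n k - binomMass p n (k + 1)) := by
  have h₁ := succ_mul p n k
  have h₂ := succ_succ p n k
  push_cast
  linear_combination h₁ - ((n : ℝ) + 1) * p * h₂

lemma eval_bernsteinPolynomial (p : ℝ) (n k : ℕ) :
    (bernsteinPolynomial ℝ n k).eval p = binomMass p n k := by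
  simp [bernsteinPolynomial, binomMass]

lemma sum_eq_one (p : ℝ) (n : ℕ) : ∑ k ∈ Finset.range (n + 1), binomMass p n k = 1 := by
  simpa [Polynomial.eval_finsetSum, eval_bernsteinPolynomial] using
    congrArg (Polynomial.eval p) (bernsteinPolynomial.sum ℝ n)

lemma variance (p : ℝ) (n : ℕ) :
    ∑ k ∈ Finset.range (n + 1), ((k : ℝ) - n * p) ^ 2 * binomMass p n k = n * p * (1 - p) := by
  have h := congrArg (Polynomial.eval p) (bernsteinPolynomial.variance ℝ n)
  simp only [Polynomial.eval_finsetSum, Polynomial.eval_mul, Polynomial.eval_pow,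
    Polynomial.eval_sub, Polynomial.eval_X, Polynomial.eval_natCast,
    Polynomial.eval_one, eval_bernsteinPolynomial, nsmul_eq_mul] at h
  rw [← h]
  exact Finset.sum_congr rfl fun k _ => by ring

lemma sum_sub_mean_mul (p : ℝ) (n k : ℕ) :
    ∑ j ∈ Finset.range (k + 1), ((j : ℝ) - ((n + 1 : ℕ) : ℝ) * p) * binomMass p (n + 1) j =
      -(((n + 1 : ℕ) : ℝ) * p * (1 - p) * binomMass p n k) := by
  induction k with
  | zero => rw [Finset.sum_range_one, sub_mean_mul_zero]
  | succ k ih =>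
    rw [Finset.sum_range_succ, ih, sub_mean_mul_succ]
    ring

lemma sum_abs_sub_mean_mul_le (hp : 0 < p) (hp1 : p < 1) {n : ℕ} (hn : 0 < n) :
    ∑ k ∈ Finset.range (n + 1), |(k : ℝ) - n * p| * binomMass p n k ≤
      √(n * p * (1 - p)) := by
  have hq : 0 < 1 - p := sub_pos.2 hp1
  have hv : 0 < (n : ℝ) * p * (1 - p) := by positivity
  have hvar := variance p n
  have hone := sum_eq_one p n
  have hs : 0 < √(n * p * (1 - p)) := Real.sqrt_pos.2 hv
  have hss := Real.mul_self_sqrt hv.le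
  set s := √(n * p * (1 - p))
  have h : 2 * s * ∑ k ∈ Finset.range (n + 1), |(k : ℝ) - n * p| * binomMass p n k ≤
      ∑ k ∈ Finset.range (n + 1), (((k : ℝ) - n * p) ^ 2 * binomMass p n k +
        s * s * binomMass p n k) := by
    rw [Finset.mul_sum]
    refine Finset.sum_le_sum fun k _ => ?_
    have := mul_nonneg (sq_nonneg (|(k : ℝ) - n * p| - s)) (nonneg hp.le hp1.le n k)
    rw [← sq_abs ((k : ℝ) - n * p)]
    linarith
  rw [Finset.sum_add_distrib, ← Finset.mul_sum, hvar, hone, ← hss] at h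
  refine le_of_mul_le_mul_left ?_ (by positivity : 0 < 2 * s)
  linarith

lemma le_inv_sqrt (hp : 0 < p) (hp1 : p < 1) {n k : ℕ} (hn : 0 < n) (hk : k ≤ n) :
    binomMass p n k ≤ 1 / √(n * p * (1 - p)) := by
  have hq : 0 < 1 - p := sub_pos.2 hp1
  have hv : 0 < (n : ℝ) * p * (1 - p) := by positivity
  have hv' : 0 < ((n + 1 : ℕ) : ℝ) * p * (1 - p) := by positivity
  have hle : √(n * p * (1 - p)) ≤ √(((n + 1 : ℕ) : ℝ) * p * (1 - p)) := by
    gcongr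
    omega
  refine le_trans ?_ (one_div_le_one_div_of_le (Real.sqrt_pos.2 hv) hle)
  have h : ((n + 1 : ℕ) : ℝ) * p * (1 - p) * binomMass p n k ≤
      √(((n + 1 : ℕ) : ℝ) * p * (1 - p)) := by
    refine le_trans ?_ (sum_abs_sub_mean_mul_le hp hp1 n.succ_pos)
    rw [← neg_neg (_ * binomMass p n k), ← sum_sub_mean_mul, ← Finset.sum_neg_distrib]
    calc _ ≤ ∑ j ∈ Finset.range (k + 1),
          |(j : ℝ) - ((n + 1 : ℕ) : ℝ) * p| * binomMass p (n + 1) j := by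
          refine Finset.sum_le_sum fun j _ => ?_
          rw [← neg_mul]
          exact mul_le_mul_of_nonneg_right (neg_le_abs _) (nonneg hp.le hp1.le _ _)
      _ ≤ _ := by
          refine Finset.sum_le_sum_of_subset_of_nonneg
            (Finset.range_subset_range.2 (by omega)) fun j _ _ => ?_
          exact mul_nonneg (abs_nonneg _) (nonneg hp.le hp1.le _ _)
  have hs := Real.sqrt_pos.2 hv'
  rw [← Real.mul_self_sqrt hv'.le, mul_assoc] at h
  rw [le_div_iff₀ hs, mul_comm]
  exact le_of_mul_le_mul_left (by simpa using h) hs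

/-- The first central moment of the squared mass function, in terms of the second one. -/
lemma two_mul_sum_sub_mean_mul_sq (p : ℝ) {n : ℕ} (hn : 0 < n) :
    2 * (n * p * (1 - p)) *
        ∑ k ∈ Finset.range (n + 1), ((k : ℝ) - n * p) * binomMass p n k ^ 2 =
      (2 * p - 1) *
        ∑ k ∈ Finset.range (n + 1), ((k : ℝ) - n * p) ^ 2 * binomMass p n k ^ 2 := by
  obtain ⟨m, rfl⟩ := Nat.exists_eq_succ_of_ne_zero hn.ne'
  simp only [Nat.succ_eq_add_one]
  set v := ((m + 1 : ℕ) : ℝ) * p * (1 - p) with hv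
  have key (k : ℕ) : ∑ j ∈ Finset.range (k + 1),
      (2 * v * (((j : ℝ) - ((m + 1 : ℕ) : ℝ) * p) * binomMass p (m + 1) j ^ 2) -
        (2 * p - 1) * (((j : ℝ) - ((m + 1 : ℕ) : ℝ) * p) ^ 2 * binomMass p (m + 1) j ^ 2)) =
      -(v ^ 2 * binomMass p m k ^ 2) := by
    induction k with
    | zero =>
      rw [Finset.sum_range_one, ← mul_pow, sq (binomMass p (m + 1) 0), ← mul_assoc (_ - _),
        sub_mean_mul_zero, succ_zero, ← hv]
      ring
    | succ k ih =>
      have hd := sub_mean_mul_succ p m k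
      rw [← hv] at hd
      rw [Finset.sum_range_succ, ih, ← mul_pow (_ - _), hd, sq (binomMass p (m + 1) (k + 1)),
        ← mul_assoc (_ - _), hd, succ_succ]
      ring
  have h := key (m + 1)
  rw [eq_zero_of_lt m.lt_succ_self, Finset.sum_sub_distrib, ← Finset.mul_sum,
    ← Finset.mul_sum] at h
  linarith

lemma abs_sum_sub_mean_mul_sq_le (hp : 0 < p) (hp1 : p < 1) {n : ℕ} (hn : 0 < n) :
    |∑ k ∈ Finset.range (n + 1), ((k : ℝ) - n * p) * binomMass p n k ^ 2| ≤
      1 / √(n * p * (1 - p)) := by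
  have hq : 0 < 1 - p := sub_pos.2 hp1
  have hv : 0 < (n : ℝ) * p * (1 - p) := by positivity
  have hs := Real.sqrt_pos.2 hv
  have hsecond : ∑ k ∈ Finset.range (n + 1), ((k : ℝ) - n * p) ^ 2 * binomMass p n k ^ 2 ≤
      n * p * (1 - p) * (1 / √(n * p * (1 - p))) := by
    refine le_of_le_of_eq ?_ (congrArg (· * (1 / √(n * p * (1 - p)))) (variance p n))
    simp only [Finset.sum_mul]
    refine Finset.sum_le_sum fun k hk => ?_
    rw [sq (binomMass p n k), ← mul_assoc]
    exact mul_le_mul_of_nonneg_left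
      (le_inv_sqrt hp hp1 hn (Nat.lt_succ_iff.1 (Finset.mem_range.1 hk)))
      (mul_nonneg (sq_nonneg _) (nonneg hp.le hp1.le n k))
  have hnn : 0 ≤ ∑ k ∈ Finset.range (n + 1), ((k : ℝ) - n * p) ^ 2 * binomMass p n k ^ 2 :=
    Finset.sum_nonneg fun k _ => by positivity
  have h := congrArg abs (two_mul_sum_sub_mean_mul_sq p hn)
  rw [abs_mul, abs_mul (2 * p - 1), abs_of_pos (by positivity : 0 < 2 * (n * p * (1 - p))),
    abs_of_nonneg hnn] at h
  have habs : |2 * p - 1| ≤ 2 := abs_le.2 ⟨by linarith, by linarith⟩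
  refine le_of_mul_le_mul_left ?_ (by positivity : 0 < 2 * (n * p * (1 - p)))
  rw [h, mul_assoc 2]
  exact mul_le_mul habs hsecond hnn zero_le_two

end binomMass

/-- The standardized first moment of the squared binomial pmf is `O(1/n)`. -/
theorem expected_squared_binom_first_moment (p : ℝ) (hp : 0 < p) (hp2 : p < 2 / 3) :
    ∃ C : ℝ, 0 < C ∧ ∃ N : ℕ, ∀ n : ℕ, N < n →
      |∑ k ∈ Finset.range (n + 1),
          ((k : ℝ) - n * p) / Real.sqrt (n * p * (1 - p)) *
            ((n.choose k : ℝ) * p ^ k * (1 - p) ^ (n - k)) ^ 2| ≤ C / n := by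
  have hp1 : p < 1 := by linarith
  have hq : 0 < 1 - p := sub_pos.2 hp1
  refine ⟨1 / (p * (1 - p)), by positivity, 0, fun n hn => ?_⟩
  have hv : 0 < (n : ℝ) * p * (1 - p) := by positivity
  have hs := Real.sqrt_pos.2 hv
  have h := div_le_div_of_nonneg_right (binomMass.abs_sum_sub_mean_mul_sq_le hp hp1 hn) hs.le
  calc _ = |∑ k ∈ Finset.range (n + 1), ((k : ℝ) - n * p) * binomMass p n k ^ 2| /
        √(n * p * (1 - p)) := by
        rw [← abs_of_pos hs, ← abs_div, Finset.sum_div, abs_of_pos hs]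
        simp only [binomMass, div_mul_eq_mul_div]
    _ ≤ _ := h
    _ = 1 / (p * (1 - p)) / n := by
        rw [div_div, Real.mul_self_sqrt hv.le, div_div]
        ring
end

section
/- Let p ∈ (0, 2/3). There exist a constant C > 0 and an integer N such that for every integer n > N, | Σ_{k=⌊np/2⌋}^{n} ( (k − np)² / (np(1−p)) ) · g_{n,k} · ( C(n,k) · p^{k} · (1−p)^{n−k} )² | ≤ C/√n, where g_{n,k} = 2^{2k} · √(np(1−p)) / ((2k+1) · C(2k,k)). -/
/-- The binomial probability mass function, extended by zero to all natural numbers. -/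
noncomputable def binomPmf (n : ℕ) (p : ℝ) (k : ℕ) : ℝ :=
  (n.choose k : ℝ) * p ^ k * (1 - p) ^ (n - k)

lemma binomPmf_nonneg (n : ℕ) {p : ℝ} (hp : 0 ≤ p) (hp1 : p ≤ 1) (k : ℕ) :
    0 ≤ binomPmf n p k := by
  have : 0 ≤ 1 - p := by linarith
  unfold binomPmf
  positivity

lemma binomPmf_eq_zero {n k : ℕ} (p : ℝ) (h : n < k) : binomPmf n p k = 0 := by
  simp [binomPmf, Nat.choose_eq_zero_of_lt h]

lemma binomPmf_eq_eval_bernsteinPolynomial (n : ℕ) (p : ℝ) (k : ℕ) :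
    binomPmf n p k = (bernsteinPolynomial ℝ n k).eval p := by
  simp [binomPmf, bernsteinPolynomial]

lemma sum_binomPmf (n : ℕ) (p : ℝ) : ∑ k ∈ Finset.range (n + 1), binomPmf n p k = 1 := by
  simp only [binomPmf_eq_eval_bernsteinPolynomial]
  rw [← Polynomial.eval_finsetSum, bernsteinPolynomial.sum, Polynomial.eval_one]

lemma sum_sq_mul_binomPmf (n : ℕ) (p : ℝ) :
    ∑ k ∈ Finset.range (n + 1), ((k : ℝ) - n * p) ^ 2 * binomPmf n p k = n * p * (1 - p) := by
  have h := congrArg (Polynomial.eval p) (bernsteinPolynomial.variance ℝ n)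
  simp only [Polynomial.eval_finsetSum, Polynomial.eval_mul, Polynomial.eval_pow,
    Polynomial.eval_sub, Polynomial.eval_natCast, Polynomial.eval_X, Polynomial.eval_one,
    nsmul_eq_mul, ← binomPmf_eq_eval_bernsteinPolynomial] at h
  rw [← h]
  exact Finset.sum_congr rfl fun k _ => by ring

lemma sum_range_binomPmf_le_one (n : ℕ) {p : ℝ} (hp : 0 ≤ p) (hp1 : p ≤ 1) (m : ℕ) :
    ∑ k ∈ Finset.range m, binomPmf n p k ≤ 1 := by
  calc ∑ k ∈ Finset.range m, binomPmf n p k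
      ≤ ∑ k ∈ Finset.range (n + 1 + m), binomPmf n p k :=
        Finset.sum_le_sum_of_subset_of_nonneg (Finset.range_mono (by omega))
          fun k _ _ => binomPmf_nonneg n hp hp1 k
    _ = ∑ k ∈ Finset.range (n + 1), binomPmf n p k := by
        rw [Finset.sum_range_add, add_eq_left]
        exact Finset.sum_eq_zero fun k _ => binomPmf_eq_zero p (by omega)
    _ = 1 := sum_binomPmf n p

lemma succ_mul_binomPmf_succ (n : ℕ) (p : ℝ) (k : ℕ) :
    ((k : ℝ) + 1) * (1 - p) * binomPmf n p (k + 1) = ((n : ℝ) - k) * p * binomPmf n p k := by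
  rcases lt_trichotomy k n with h | rfl | h
  · have hc : (n.choose (k + 1) : ℝ) * (k + 1) = n.choose k * (n - k) := by
      have := Nat.choose_succ_right_eq n k
      rw [← Nat.cast_sub h.le]
      exact_mod_cast this
    have hq : (1 - p) ^ (n - k) = (1 - p) * (1 - p) ^ (n - (k + 1)) := by
      rw [← pow_succ']
      congr 1
      omega
    unfold binomPmf
    rw [hq, pow_succ]
    linear_combination p ^ k * p * (1 - p) * (1 - p) ^ (n - (k + 1)) * hc
  · simp [binomPmf_eq_zero p (Nat.lt_succ_self k)]
  · simp [binomPmf_eq_zero p h, binomPmf_eq_zero p (h.trans (Nat.lt_succ_self k))]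

lemma exists_forall_binomPmf_le (n : ℕ) {p : ℝ} (hp : 0 ≤ p) (hp1 : p ≤ 1) :
    ∃ m, ∀ k, binomPmf n p k ≤ binomPmf n p m := by
  obtain ⟨m, -, hm⟩ := Finset.exists_max_image (Finset.range (n + 1)) (binomPmf n p) (by simp)
  refine ⟨m, fun k => ?_⟩
  by_cases hk : k ∈ Finset.range (n + 1)
  · exact hm k hk
  · rw [binomPmf_eq_zero p (by simpa using hk)]
    exact binomPmf_nonneg n hp hp1 m

/-- The binomial pmf decays at most quadratically to the right of a mode. -/
lemma binomPmf_mode_add_ge (n : ℕ) {p : ℝ} (hp : 0 < p) (hp1 : p < 1) {m : ℕ}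
    (hm : ∀ k, binomPmf n p k ≤ binomPmf n p m) (j : ℕ) :
    binomPmf n p m * (1 - (j : ℝ) ^ 2 / ((n + 1) * p * (1 - p))) ≤ binomPmf n p (m + j) := by
  have hq : 0 < 1 - p := by linarith
  have hpos : 0 < binomPmf n p m :=
    lt_of_lt_of_le (by simp only [binomPmf, Nat.choose_zero_right]; positivity) (hm 0)
  have hlow : ((n : ℝ) + 1) * p ≤ m + 1 := by
    have h1 := succ_mul_binomPmf_succ n p m
    have h2 := mul_le_mul_of_nonneg_left (hm (m + 1)) (by positivity : 0 ≤ ((m : ℝ) + 1) * (1 - p))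
    have h3 := le_of_mul_le_mul_right (h1 ▸ h2) hpos
    linarith
  have hupp : (m : ℝ) ≤ (n + 1) * p := by
    rcases m with _ | l
    · push_cast
      positivity
    have h1 := succ_mul_binomPmf_succ n p l
    have hln : l + 1 ≤ n := by
      by_contra! h
      exact hpos.ne' (binomPmf_eq_zero p h)
    have hln' : (l : ℝ) + 1 ≤ n := by exact_mod_cast hln
    have h2 := mul_le_mul_of_nonneg_left (hm l)
      (mul_nonneg (by linarith) hp.le : 0 ≤ ((n : ℝ) - l) * p)
    have h3 := le_of_mul_le_mul_right (h1.symm ▸ h2) hpos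
    push_cast
    linarith
  have hD : 0 < ((n : ℝ) + 1) * p * (1 - p) := by positivity
  induction j with
  | zero => simp
  | succ j ih =>
    have hk := succ_mul_binomPmf_succ n p (m + j)
    push_cast at hk
    have hA : 0 < ((m : ℝ) + j + 1) * (1 - p) := by positivity
    have hstep : binomPmf n p (m + j) - binomPmf n p (m + j + 1) ≤
        (j + 1) / ((n + 1) * p * (1 - p)) * binomPmf n p m := by
      have heq : binomPmf n p (m + j) - binomPmf n p (m + j + 1) =
          (m + j + 1 - (n + 1) * p) / ((m + j + 1) * (1 - p)) * binomPmf n p (m + j) := by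
        field_simp
        linear_combination -hk
      rw [heq]
      have hj : (0 : ℝ) ≤ j := j.cast_nonneg
      gcongr
      · exact binomPmf_nonneg n hp.le hp1.le _
      · linarith
      · linarith
      · exact hm _
    have hsq : ((j : ℝ) ^ 2 + (j + 1)) / ((n + 1) * p * (1 - p)) ≤
        ((j + 1 : ℕ) : ℝ) ^ 2 / ((n + 1) * p * (1 - p)) := by
      gcongr
      push_cast
      nlinarith [(j.cast_nonneg : (0 : ℝ) ≤ j)]
    have := mul_le_mul_of_nonneg_left hsq hpos.le
    rw [add_div] at this
    rw [← add_assoc]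
    linarith

lemma binomPmf_le_div_sqrt (n : ℕ) {p : ℝ} (hp : 0 < p) (hp1 : p < 1) (hn : 0 < n) (k : ℕ) :
    binomPmf n p k ≤ 4 / √(n * p * (1 - p)) := by
  obtain ⟨m, hm⟩ := exists_forall_binomPmf_le n hp.le hp1.le
  refine (hm k).trans ?_
  have hq : 0 < 1 - p := by linarith
  have hn' : (0 : ℝ) < n := by exact_mod_cast hn
  set s := √(n * p * (1 - p)) with hs
  have hs0 : 0 < s := Real.sqrt_pos.2 (by positivity)
  have hs2 : s ^ 2 = n * p * (1 - p) := Real.sq_sqrt (by positivity)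
  have hterm : ∀ j ∈ Finset.range (⌊s / 2⌋₊ + 1), binomPmf n p m / 2 ≤ binomPmf n p (m + j) := by
    intro j hj
    refine le_trans ?_ (binomPmf_mode_add_ge n hp hp1 hm j)
    have hj' : (j : ℝ) ≤ s / 2 :=
      (Nat.le_floor_iff (by positivity)).1 (Nat.lt_succ_iff.1 (Finset.mem_range.1 hj))
    have hj2 : (j : ℝ) ^ 2 ≤ (s / 2) ^ 2 := by gcongr
    have : (j : ℝ) ^ 2 / ((n + 1) * p * (1 - p)) ≤ 1 / 2 := by
      rw [div_le_iff₀ (by positivity)]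
      nlinarith [mul_pos hp hq]
    rw [div_eq_mul_one_div]
    exact mul_le_mul_of_nonneg_left (by linarith) (binomPmf_nonneg n hp.le hp1.le m)
  have hsum := Finset.card_nsmul_le_sum _ _ _ hterm
  have htotal := sum_range_binomPmf_le_one n hp.le hp1.le (m + (⌊s / 2⌋₊ + 1))
  rw [Finset.sum_range_add] at htotal
  have hinit : 0 ≤ ∑ i ∈ Finset.range m, binomPmf n p i :=
    Finset.sum_nonneg fun i _ => binomPmf_nonneg n hp.le hp1.le i
  rw [Finset.card_range, nsmul_eq_mul] at hsum
  push_cast at hsum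
  have hfloor := (Nat.lt_floor_add_one (s / 2)).le
  have := mul_le_mul_of_nonneg_right hfloor
    (half_pos (lt_of_lt_of_le (by simp only [binomPmf, Nat.choose_zero_right]; positivity)
      (hm 0))).le
  rw [le_div_iff₀ hs0]
  linarith

lemma sixteen_pow_le_mul_centralBinom_sq (k : ℕ) :
    16 ^ k ≤ (4 * k + 1) * k.centralBinom ^ 2 := by
  induction k with
  | zero => simp
  | succ k ih =>
    have h := Nat.succ_mul_centralBinom_succ k
    refine Nat.le_of_mul_le_mul_left (c := (k + 1) ^ 2) ?_ (by positivity)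
    calc (k + 1) ^ 2 * 16 ^ (k + 1) = 16 * (k + 1) ^ 2 * 16 ^ k := by ring
      _ ≤ 16 * (k + 1) ^ 2 * ((4 * k + 1) * k.centralBinom ^ 2) := by gcongr
      _ = 16 * (k + 1) ^ 2 * (4 * k + 1) * k.centralBinom ^ 2 := by ring
      _ ≤ 4 * (2 * k + 1) ^ 2 * (4 * k + 5) * k.centralBinom ^ 2 := by
        gcongr ?_ * _
        nlinarith
      _ = (2 * (2 * k + 1) * k.centralBinom) ^ 2 * (4 * k + 5) := by ring
      _ = ((k + 1) * (k + 1).centralBinom) ^ 2 * (4 * k + 5) := by rw [h]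
      _ = (k + 1) ^ 2 * ((4 * (k + 1) + 1) * (k + 1).centralBinom ^ 2) := by ring

lemma two_pow_mul_sqrt_div_le_two {k : ℕ} {v : ℝ} (hv : v ≤ 2 * (k + 1)) :
    (2 : ℝ) ^ (2 * k) * √v / ((2 * (k : ℝ) + 1) * ((2 * k).choose k)) ≤ 2 := by
  have hc : (0 : ℝ) < (2 * k).choose k := by exact_mod_cast k.centralBinom_pos
  rw [div_le_iff₀ (by positivity)]
  refine le_trans (mul_le_mul_of_nonneg_left (Real.sqrt_le_sqrt hv) (by positivity)) ?_
  refine abs_le_of_sq_le_sq' ?_ (by positivity) |>.2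
  rw [mul_pow, Real.sq_sqrt (by positivity)]
  have h16 : (16 : ℝ) ^ k ≤ (4 * k + 1) * ((2 * k).choose k : ℝ) ^ 2 := by
    exact_mod_cast sixteen_pow_le_mul_centralBinom_sq k
  have h2 : ((2 : ℝ) ^ (2 * k)) ^ 2 = 16 ^ k := by
    rw [← pow_mul, mul_comm 2 k, mul_assoc, mul_comm k, pow_mul]
    norm_num
  rw [h2]
  calc (16 : ℝ) ^ k * (2 * (k + 1))
      ≤ (4 * k + 1) * ((2 * k).choose k : ℝ) ^ 2 * (2 * (k + 1)) := by gcongr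
    _ = (4 * k + 1) * (2 * (k + 1)) * ((2 * k).choose k : ℝ) ^ 2 := by ring
    _ ≤ (2 * (2 * k + 1)) ^ 2 * ((2 * k).choose k : ℝ) ^ 2 := by
      gcongr ?_ * _
      nlinarith [(k.cast_nonneg : (0 : ℝ) ≤ k)]
    _ = (2 * ((2 * k + 1) * ((2 * k).choose k))) ^ 2 := by ring

/-- The standardized second moment of the squared binomial pmf weighted by
`g_{n,k} = 2^(2k)√(np(1−p))/((2k+1)C(2k,k))` is `O(1/√n)`. -/
theorem weighted_squared_binom_second_moment (p : ℝ) (hp : 0 < p) (hp2 : p < 2 / 3) :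
    ∃ C : ℝ, 0 < C ∧ ∃ N : ℕ, ∀ n : ℕ, N < n →
      |∑ k ∈ Finset.Icc ⌊(n : ℝ) * p / 2⌋₊ n,
          ((k : ℝ) - n * p) ^ 2 / (n * p * (1 - p)) *
            ((2 : ℝ) ^ (2 * k) * Real.sqrt (n * p * (1 - p)) /
              ((2 * (k : ℝ) + 1) * ((2 * k).choose k))) *
            ((n.choose k : ℝ) * p ^ k * (1 - p) ^ (n - k)) ^ 2| ≤ C / Real.sqrt n := by
  have hq : 0 < 1 - p := by linarith
  refine ⟨8 / √(p * (1 - p)), by positivity, 0, fun n hn => ?_⟩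
  have hn' : (0 : ℝ) < n := by exact_mod_cast hn
  have hv : 0 < n * p * (1 - p) := by positivity
  rw [abs_of_nonneg (Finset.sum_nonneg fun k _ => by positivity)]
  calc _ ≤ ∑ k ∈ Finset.Icc ⌊(n : ℝ) * p / 2⌋₊ n, ((k : ℝ) - n * p) ^ 2 / (n * p * (1 - p)) *
          2 * (4 / √(n * p * (1 - p)) * binomPmf n p k) := by
        refine Finset.sum_le_sum fun k hk => ?_
        have hk0 : (⌊(n : ℝ) * p / 2⌋₊ : ℝ) ≤ k := by exact_mod_cast (Finset.mem_Icc.1 hk).1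
        have hk1 : (n : ℝ) * p / 2 < k + 1 := (Nat.lt_floor_add_one _).trans_le (by gcongr)
        have hg := two_pow_mul_sqrt_div_le_two (k := k) (v := n * p * (1 - p))
          (by nlinarith [mul_pos hn' hp])
        have hP : ((n.choose k : ℝ) * p ^ k * (1 - p) ^ (n - k)) ^ 2 ≤
            4 / √(n * p * (1 - p)) * binomPmf n p k := by
          rw [sq]
          exact mul_le_mul_of_nonneg_right (binomPmf_le_div_sqrt n hp (by linarith) hn k)
            (binomPmf_nonneg n hp.le (by linarith) k)
        gcongr
    _ ≤ ∑ k ∈ Finset.range (n + 1), ((k : ℝ) - n * p) ^ 2 / (n * p * (1 - p)) *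
          2 * (4 / √(n * p * (1 - p)) * binomPmf n p k) := by
        refine Finset.sum_le_sum_of_subset_of_nonneg (fun k hk => ?_) fun k _ _ => ?_
        · exact Finset.mem_range.2 (Nat.lt_succ_of_le (Finset.mem_Icc.1 hk).2)
        · have := binomPmf_nonneg n hp.le (by linarith) k
          positivity
    _ = 8 / (n * p * (1 - p)) / √(n * p * (1 - p)) *
          ∑ k ∈ Finset.range (n + 1), ((k : ℝ) - n * p) ^ 2 * binomPmf n p k := by
        rw [Finset.mul_sum]
        exact Finset.sum_congr rfl fun k _ => by ring
    _ = 8 / √(p * (1 - p)) / √n := by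
        rw [sum_sq_mul_binomPmf, div_right_comm, div_mul_cancel₀ _ hv.ne', mul_assoc,
          Real.sqrt_mul hn'.le, mul_comm, div_div]
end

section
/- Let p ∈ (0, 2/3). There exist a constant C > 0 and an integer N such that for every integer n > N, | Σ_{k=⌊np/2⌋}^{n} ( (k − np) / √(np(1−p)) ) · g_{n,k} · ( C(n,k) · p^{k} · (1−p)^{n−k} )² | ≤ C/n, where g_{n,k} = 2^{2k} · √(np(1−p)) / ((2k+1) · C(2k,k)). -/
open Finset

/-- The binomial probability mass function. -/
noncomputable def binomPMF (n : ℕ) (p : ℝ) (k : ℕ) : ℝ :=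
  n.choose k * p ^ k * (1 - p) ^ (n - k)

/-- The weight `4 ^ k / ((2k+1) C(2k,k))`. -/
noncomputable def centralWeight (k : ℕ) : ℝ :=
  (2 : ℝ) ^ (2 * k) / ((2 * (k : ℝ) + 1) * ((2 * k).choose k))

lemma binomPMF_nonneg {n : ℕ} {p : ℝ} (hp : 0 ≤ p) (hp1 : p ≤ 1) (k : ℕ) :
    0 ≤ binomPMF n p k := by
  have : 0 ≤ 1 - p := by linarith
  unfold binomPMF
  positivity

lemma binomPMF_succ {n k : ℕ} (p : ℝ) (hk : k ≤ n) :
    ((k : ℝ) + 1) * (1 - p) * binomPMF n p (k + 1) = ((n : ℝ) - k) * p * binomPMF n p k := by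
  unfold binomPMF
  rcases hk.eq_or_lt with rfl | hlt
  · simp
  · have h : (n.choose (k + 1) : ℝ) * (k + 1) = n.choose k * ((n : ℝ) - k) := by
      rw [← Nat.cast_sub hk]
      exact_mod_cast Nat.choose_succ_right_eq n k
    obtain ⟨d, rfl⟩ := Nat.exists_eq_add_of_lt hlt
    have e1 : k + d + 1 - (k + 1) = d := by omega
    have e2 : k + d + 1 - k = d + 1 := by omega
    rw [e1, e2, pow_succ, pow_succ]
    linear_combination p ^ k * p * (1 - p) ^ d * (1 - p) * h

lemma sum_binomPMF (n : ℕ) (p : ℝ) : ∑ k ∈ range (n + 1), binomPMF n p k = 1 := by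
  have h := congrArg (Polynomial.eval p) (bernsteinPolynomial.sum ℝ n)
  simpa [Polynomial.eval_finsetSum, bernsteinPolynomial, binomPMF] using h

lemma sum_mul_binomPMF (n : ℕ) (p : ℝ) :
    ∑ k ∈ range (n + 1), (k : ℝ) * binomPMF n p k = n * p := by
  have h := congrArg (Polynomial.eval p) (bernsteinPolynomial.sum_smul ℝ n)
  simpa [Polynomial.eval_finsetSum, bernsteinPolynomial, binomPMF] using h

lemma sum_sq_mul_binomPMF (n : ℕ) (p : ℝ) :
    ∑ k ∈ range (n + 1), ((k : ℝ) - n * p) ^ 2 * binomPMF n p k = n * p * (1 - p) := by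
  have h := congrArg (Polynomial.eval p) (bernsteinPolynomial.variance ℝ n)
  simp only [Polynomial.eval_finsetSum, bernsteinPolynomial] at h
  simp at h
  rw [← h]
  refine sum_congr rfl fun k _ => ?_
  unfold binomPMF
  ring

/-- Chebyshev's inequality for a single atom. -/
lemma sq_mul_binomPMF_le {n k : ℕ} {p : ℝ} (hp : 0 ≤ p) (hp1 : p ≤ 1) (hk : k ≤ n) :
    ((k : ℝ) - n * p) ^ 2 * binomPMF n p k ≤ n * p * (1 - p) := by
  rw [← sum_sq_mul_binomPMF]
  exact single_le_sum (f := fun k : ℕ => ((k : ℝ) - n * p) ^ 2 * binomPMF n p k)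
    (fun i _ => mul_nonneg (sq_nonneg _) (binomPMF_nonneg hp hp1 i))
    (mem_range.2 (by omega))

lemma sum_range_sub_mul_binomPMF {n j : ℕ} (p : ℝ) (hj : j ≤ n + 1) :
    ∑ k ∈ range j, ((n : ℝ) * p - k) * binomPMF n p k = j * (1 - p) * binomPMF n p j := by
  induction j with
  | zero => simp
  | succ j ih =>
    rw [sum_range_succ, ih (by omega)]
    push_cast
    rw [binomPMF_succ p (by omega)]
    ring

lemma mul_binomPMF_le_sqrt {n j : ℕ} {p : ℝ} (hp : 0 ≤ p) (hp1 : p ≤ 1) (hn : 0 < n)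
    (hj : j ≤ n + 1) : j * (1 - p) * binomPMF n p j ≤ √n := by
  have hs : 0 < √(n : ℝ) := Real.sqrt_pos.2 (by exact_mod_cast hn)
  have hss : √(n : ℝ) ^ 2 = n := Real.sq_sqrt (by positivity)
  have hb := binomPMF_nonneg (n := n) hp hp1
  rw [← sum_range_sub_mul_binomPMF p hj]
  have key (x : ℝ) : √n * |x| ≤ (x ^ 2 + n) / 2 := by
    nlinarith [sq_nonneg (√(n : ℝ) - |x|), sq_abs x]
  have h1 : √n * ∑ k ∈ range j, ((n : ℝ) * p - k) * binomPMF n p k ≤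
      ∑ k ∈ range (n + 1), (((k : ℝ) - n * p) ^ 2 + n) / 2 * binomPMF n p k := by
    rw [mul_sum]
    calc _ ≤ ∑ k ∈ range j, (((k : ℝ) - n * p) ^ 2 + n) / 2 * binomPMF n p k := by
          refine sum_le_sum fun k _ => ?_
          rw [← mul_assoc]
          refine mul_le_mul_of_nonneg_right ?_ (hb k)
          refine le_trans ?_ (key _)
          rw [abs_sub_comm]
          exact mul_le_mul_of_nonneg_left (le_abs_self _) hs.le
      _ ≤ _ := sum_le_sum_of_subset_of_nonneg (range_mono hj)
          fun k _ _ => mul_nonneg (by positivity) (hb k)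
  have h2 : ∑ k ∈ range (n + 1), (((k : ℝ) - n * p) ^ 2 + n) / 2 * binomPMF n p k =
      (n * p * (1 - p) + n) / 2 := by
    have hone : ∑ k ∈ range (n + 1), (n : ℝ) * binomPMF n p k = n := by
      rw [← mul_sum, sum_binomPMF, mul_one]
    calc _ = (∑ k ∈ range (n + 1), ((k : ℝ) - n * p) ^ 2 * binomPMF n p k +
          ∑ k ∈ range (n + 1), (n : ℝ) * binomPMF n p k) / 2 := by
          rw [← sum_add_distrib, sum_div]
          exact sum_congr rfl fun k _ => by ring
      _ = _ := by rw [sum_sq_mul_binomPMF, hone]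
  have h3 : (n : ℝ) * p * (1 - p) ≤ n := by
    have : p * (1 - p) ≤ 1 := by nlinarith
    nlinarith [(Nat.cast_nonneg n : (0 : ℝ) ≤ n)]
  rw [h2] at h1
  refine le_of_mul_le_mul_left (h1.trans ?_) hs
  nlinarith

lemma centralWeight_zero : centralWeight 0 = 1 := by simp [centralWeight]

lemma centralWeight_pos (k : ℕ) : 0 < centralWeight k := by
  have : 0 < (2 * k).choose k := Nat.choose_pos (by omega)
  unfold centralWeight
  positivity

lemma centralWeight_succ (k : ℕ) :
    centralWeight (k + 1) = centralWeight k * ((2 * k + 2) / (2 * k + 3)) := by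
  have h : ((k : ℝ) + 1) * ((2 * (k + 1)).choose (k + 1) : ℝ) =
      2 * (2 * k + 1) * ((2 * k).choose k : ℝ) := by
    exact_mod_cast Nat.succ_mul_centralBinom_succ k
  have h0 : (0 : ℝ) < (2 * k).choose k := by exact_mod_cast Nat.choose_pos (by omega)
  have h1 : (0 : ℝ) < (2 * (k + 1)).choose (k + 1) := by
    exact_mod_cast Nat.choose_pos (by omega)
  unfold centralWeight
  rw [div_mul_div_comm, div_eq_div_iff (by positivity) (by positivity)]
  push_cast
  rw [mul_add, pow_add]
  linear_combination (-(2 : ℝ) ^ (2 * k) * 2 * (2 * k + 3)) * h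

lemma centralWeight_sub_succ (k : ℕ) :
    centralWeight k - centralWeight (k + 1) = centralWeight k / (2 * k + 3) := by
  rw [centralWeight_succ]
  field_simp
  ring

lemma centralWeight_sq_le (k : ℕ) : centralWeight k ^ 2 ≤ 1 / (k + 1) := by
  induction k with
  | zero => simp [centralWeight_zero]
  | succ k ih =>
    rw [centralWeight_succ, mul_pow]
    refine (mul_le_mul_of_nonneg_right ih (by positivity)).trans ?_
    push_cast
    rw [div_pow, div_mul_div_comm, div_le_div_iff₀ (by positivity) (by positivity)]
    have : (0 : ℝ) ≤ k := by positivity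
    nlinarith [mul_nonneg this this]

lemma centralWeight_le_one (k : ℕ) : centralWeight k ≤ 1 := by
  have h := centralWeight_sq_le k
  have : (1 : ℝ) / (k + 1) ≤ 1 := by
    rw [div_le_one (by positivity)]
    have : (0 : ℝ) ≤ k := by positivity
    linarith
  nlinarith [centralWeight_pos k]

/-- Abel summation over an integer interval. -/
lemma sum_Icc_sub_mul (F a : ℕ → ℝ) {m n : ℕ} (h : m ≤ n) :
    ∑ k ∈ Icc m n, (F k - F (k + 1)) * a k =
      F m * a m - F (n + 1) * a n + ∑ k ∈ Ico m n, F (k + 1) * (a (k + 1) - a k) := by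
  induction n, h using Nat.le_induction with
  | base => simp; ring
  | succ n h ih =>
    rw [← insert_Icc_right_eq_Icc_add_one (by omega), sum_insert (by simp), ih, sum_Ico_succ_top h]
    ring

/-- The factor `(n-k)p + kq`, with `q = 1 - p`, in
`(n-k)²p² - k²q² = (np - k)((n-k)p + kq)`. -/
noncomputable def stepFactor (n : ℕ) (p : ℝ) (k : ℕ) : ℝ := ((n : ℝ) - k) * p + k * (1 - p)

lemma le_stepFactor {n k : ℕ} {p : ℝ} (hp : 0 ≤ p) (hp1 : p ≤ 1) (hk : k ≤ n) :
    p * (1 - p) * n ≤ stepFactor n p k := by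
  have h1 : (0 : ℝ) ≤ (n : ℝ) - k := sub_nonneg.2 (by exact_mod_cast hk)
  have h2 : (0 : ℝ) ≤ k := by positivity
  unfold stepFactor
  nlinarith [mul_nonneg h1 (mul_nonneg hp hp),
    mul_nonneg h2 (mul_nonneg (sub_nonneg.2 hp1) (sub_nonneg.2 hp1))]

lemma sub_mul_binomPMF_sq {n k : ℕ} {p : ℝ} (hk : k ≤ n) :
    ((k : ℝ) - n * p) * stepFactor n p k * binomPMF n p k ^ 2 =
      (k * (1 - p) * binomPMF n p k) ^ 2 -
        (((k + 1 : ℕ) : ℝ) * (1 - p) * binomPMF n p (k + 1)) ^ 2 := by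
  push_cast
  rw [binomPMF_succ p hk]
  unfold stepFactor
  ring

lemma abs_weight_div_stepFactor_sub_le {n k : ℕ} {p : ℝ} (hp : 0 < p) (hp1 : p < 1)
    (hk : k < n) (hnk : n * p / 2 ≤ (k : ℝ) + 1) :
    √n * |centralWeight (k + 1) / stepFactor n p (k + 1) - centralWeight k / stepFactor n p k| ≤
      √(2 / p) * (1 / (p * (p * (1 - p))) + 1 / (p * (1 - p)) ^ 2) / n ^ 2 := by
  have hn : (0 : ℝ) < n := by exact_mod_cast (by omega : 0 < n)
  have hq : 0 < 1 - p := by linarith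
  set c := p * (1 - p) with hc
  have hc0 : 0 < c := by positivity
  have hD := le_stepFactor hp.le hp1.le hk.le
  have hD' := le_stepFactor hp.le hp1.le (show k + 1 ≤ n from hk)
  have hw := centralWeight_pos k
  have hcn : 0 < c * n := by positivity
  rw [← hc] at hD hD'
  have hd0 := hcn.trans_le hD
  have hd1 := hcn.trans_le hD'
  have hsub : stepFactor n p (k + 1) - stepFactor n p k = 1 - 2 * p := by
    unfold stepFactor; push_cast; ring
  have hsplit : centralWeight (k + 1) / stepFactor n p (k + 1) -
      centralWeight k / stepFactor n p k =
      -(centralWeight k * (1 / ((2 * k + 3) * stepFactor n p (k + 1)) +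
        (1 - 2 * p) / (stepFactor n p k * stepFactor n p (k + 1)))) := by
    have h := centralWeight_sub_succ k
    rw [show centralWeight (k + 1) = centralWeight k - centralWeight k / (2 * k + 3) by linarith,
      ← hsub]
    field_simp
    ring
  have hA : |1 / ((2 * k + 3) * stepFactor n p (k + 1)) +
      (1 - 2 * p) / (stepFactor n p k * stepFactor n p (k + 1))| ≤
      (1 / (p * c) + 1 / c ^ 2) / n ^ 2 := by
    rw [add_div, div_div, div_div]
    refine (abs_add_le _ _).trans (add_le_add ?_ ?_)
    · rw [abs_of_pos (by positivity)]
      refine one_div_le_one_div_of_le (by positivity) ?_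
      calc p * c * (n : ℝ) ^ 2 = (p * n) * (c * n) := by ring
        _ ≤ _ := mul_le_mul (by linarith) hD' hcn.le (by positivity)
    · rw [abs_div, abs_of_pos (mul_pos hd0 hd1)]
      refine div_le_div₀ zero_le_one (abs_le.2 ⟨by linarith, by linarith⟩) (by positivity) ?_
      calc c ^ 2 * (n : ℝ) ^ 2 = (c * n) * (c * n) := by ring
        _ ≤ _ := mul_le_mul hD hD' hcn.le hd0.le
  have hW : √n * centralWeight k ≤ √(2 / p) := by
    refine Real.le_sqrt_of_sq_le ?_
    rw [mul_pow, Real.sq_sqrt hn.le]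
    refine (mul_le_mul_of_nonneg_left (centralWeight_sq_le k) hn.le).trans ?_
    rw [mul_one_div, div_le_div_iff₀ (by positivity) hp]
    linarith
  rw [hsplit, abs_neg, abs_mul, abs_of_pos hw, ← mul_assoc, mul_div_assoc]
  exact mul_le_mul hW hA (abs_nonneg _) (by positivity)

lemma sq_mul_binomPMF_floor_le {n m : ℕ} {p : ℝ} (hp : 0 < p) (hp1 : p < 1) (hn : 0 < n)
    (hm : (m : ℝ) ≤ n * p / 2) (hmn : m ≤ n) :
    (m * (1 - p) * binomPMF n p m) ^ 2 ≤ 4 := by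
  have hn' : (0 : ℝ) < n := by exact_mod_cast hn
  have hq : 0 < 1 - p := by linarith
  have hb := binomPMF_nonneg (n := n) hp.le hp1.le m
  have hx : (n * p / 2) ^ 2 ≤ ((m : ℝ) - n * p) ^ 2 := by
    have : 0 < n * p := by positivity
    nlinarith
  have h1 := (mul_le_mul_of_nonneg_right hx hb).trans (sq_mul_binomPMF_le hp.le hp1.le hmn)
  have h2 : n * p * binomPMF n p m ≤ 4 * (1 - p) := by
    refine le_of_mul_le_mul_left ?_ (show 0 < n * p / 4 by positivity)
    linarith
  have h3 : m * (1 - p) * binomPMF n p m ≤ 2 := by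
    calc m * (1 - p) * binomPMF n p m ≤ (n * p / 2) * 1 * binomPMF n p m := by
          gcongr
          linarith
      _ ≤ 2 := by linarith
  have h4 : 0 ≤ m * (1 - p) * binomPMF n p m := by positivity
  nlinarith


/-- The standardized first moment of the squared binomial pmf weighted by
`g_{n,k} = 2^(2k)√(np(1−p))/((2k+1)C(2k,k))` is `O(1/n)`. -/
theorem weighted_squared_binom_first_moment (p : ℝ) (hp : 0 < p) (hp2 : p < 2 / 3) :
    ∃ C : ℝ, 0 < C ∧ ∃ N : ℕ, ∀ n : ℕ, N < n →
      |∑ k ∈ Finset.Icc ⌊(n : ℝ) * p / 2⌋₊ n,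
          ((k : ℝ) - n * p) / Real.sqrt (n * p * (1 - p)) *
            ((2 : ℝ) ^ (2 * k) * Real.sqrt (n * p * (1 - p)) /
              ((2 * (k : ℝ) + 1) * ((2 * k).choose k))) *
            ((n.choose k : ℝ) * p ^ k * (1 - p) ^ (n - k)) ^ 2| ≤ C / n := by
  have hp1 : p < 1 := by linarith
  have hq : 0 < 1 - p := by linarith
  set c := p * (1 - p) with hc
  have hc0 : 0 < c := by positivity
  set B := √(2 / p) * (1 / (p * c) + 1 / c ^ 2) with hB
  have hB0 : 0 ≤ B := by positivity
  refine ⟨4 / c + B, by positivity, 0, fun n hn => ?_⟩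
  have hn' : (0 : ℝ) < n := by exact_mod_cast hn
  set m := ⌊(n : ℝ) * p / 2⌋₊ with hm
  have hm1 : (m : ℝ) ≤ n * p / 2 := Nat.floor_le (by positivity)
  have hm2 : n * p / 2 < (m : ℝ) + 1 := Nat.lt_floor_add_one _
  have hmn : m ≤ n := by
    have : (m : ℝ) ≤ n := by nlinarith
    exact_mod_cast this
  let G : ℕ → ℝ := fun k => k * (1 - p) * binomPMF n p k
  let a : ℕ → ℝ := fun k => centralWeight k / stepFactor n p k
  have hG0 (k : ℕ) : 0 ≤ G k := mul_nonneg (by positivity) (binomPMF_nonneg hp.le hp1.le k)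
  have hG : G (n + 1) = 0 := by simp [G, binomPMF]
  have hD {k : ℕ} (hk : k ≤ n) : c * n ≤ stepFactor n p k := le_stepFactor hp.le hp1.le hk
  have hcn : 0 < c * n := by positivity
  have hsum : ∑ k ∈ Icc m n,
      ((k : ℝ) - n * p) / √(n * p * (1 - p)) *
        ((2 : ℝ) ^ (2 * k) * √(n * p * (1 - p)) / ((2 * (k : ℝ) + 1) * ((2 * k).choose k))) *
        ((n.choose k : ℝ) * p ^ k * (1 - p) ^ (n - k)) ^ 2 =
      ∑ k ∈ Icc m n, (G k ^ 2 - G (k + 1) ^ 2) * a k := by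
    refine sum_congr rfl fun k hk => ?_
    have hkn := (mem_Icc.1 hk).2
    have hs : √(n * p * (1 - p)) ≠ 0 := (Real.sqrt_pos.2 (by positivity)).ne'
    have hd := (hcn.trans_le (hD hkn)).ne'
    rw [← sub_mul_binomPMF_sq hkn]
    simp only [a, centralWeight, binomPMF]
    field_simp
  rw [hsum, sum_Icc_sub_mul (fun k => G k ^ 2) a hmn]
  simp only [hG]
  have hbdry : |G m ^ 2 * a m| ≤ 4 / c / n := by
    have ha : 0 ≤ a m := div_nonneg (centralWeight_pos m).le (hcn.le.trans (hD hmn))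
    rw [abs_of_nonneg (by positivity), div_div, ← mul_one_div]
    exact mul_le_mul (sq_mul_binomPMF_floor_le hp hp1 hn hm1 hmn)
      (div_le_div₀ zero_le_one (centralWeight_le_one m) hcn (hD hmn)) ha (by norm_num)
  have hGsum : ∑ k ∈ Ico m n, G (k + 1) ≤ n := by
    calc ∑ k ∈ Ico m n, G (k + 1) ≤ ∑ k ∈ range n, G (k + 1) :=
          sum_le_sum_of_subset_of_nonneg (fun k hk => by simp at hk ⊢; omega) fun k _ _ => hG0 _
      _ = ∑ k ∈ range (n + 1), G k := by rw [sum_range_succ' G n]; simp [G]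
      _ = (1 - p) * (n * p) := by
          rw [← sum_mul_binomPMF n p, mul_sum]
          exact sum_congr rfl fun k _ => by simp only [G]; ring
      _ ≤ n := by nlinarith [mul_nonneg hn'.le hp.le]
  have hmain : |∑ k ∈ Ico m n, G (k + 1) ^ 2 * (a (k + 1) - a k)| ≤ B / n := by
    calc _ ≤ ∑ k ∈ Ico m n, G (k + 1) * (B / n ^ 2) := by
          refine (abs_sum_le_sum_abs _ _).trans (sum_le_sum fun k hk => ?_)
          obtain ⟨hmk, hkn⟩ := mem_Ico.1 hk
          have hmk' : (m : ℝ) ≤ k := by exact_mod_cast hmk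
          rw [abs_mul, abs_of_nonneg (sq_nonneg _), pow_two, mul_assoc]
          refine mul_le_mul_of_nonneg_left ?_ (hG0 _)
          exact (mul_le_mul_of_nonneg_right
            (mul_binomPMF_le_sqrt hp.le hp1.le hn (by omega)) (abs_nonneg _)).trans
            (abs_weight_div_stepFactor_sub_le hp hp1 hkn (by linarith))
      _ = (∑ k ∈ Ico m n, G (k + 1)) * (B / n ^ 2) := (sum_mul _ _ _).symm
      _ ≤ n * (B / n ^ 2) := mul_le_mul_of_nonneg_right hGsum (by positivity)
      _ = B / n := by field_simp
  rw [add_div]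
  refine (abs_add_le _ _).trans (add_le_add ?_ hmain)
  simpa using hbdry
end

section
/- Fix a, b ∈ (0, 1/6), π₁ ∈ [1/3, 1/2), and π₃ = 1/2 − π₁, and for an even positive integer n and integer 0 ≤ q ≤ n/2 write M(n,q) = n!/(((n/2−q)!)²·(q!)²) · π₁^{n−2q} · π₃^{2q}. Then, with n ranging over positive multiples of 6: (i) if π₃ ≥ a there exist constants 0 < c₁ ≤ c₂ and N such that c₁/n ≤ Σ_{q=⌊an⌋}^{n/6} M(n,q) ≤ c₂/n for all such n > N, while if π₃ < a there exist C, c > 0 with Σ_{q=⌊an⌋}^{n/6} M(n,q) ≤ C·e^{−cn}; (ii) if π₃ ≤ b there exist constants 0 < c₁ ≤ c₂ and N such that c₁/n ≤ Σ_{q=0}^{⌈bn⌉} M(n,q) ≤ c₂/n for all such n > N, while if π₃ > b there exist C, c > 0 with Σ_{q=0}^{⌈bn⌉} M(n,q) ≤ C·e^{−cn}. -/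
/-- The symmetric multinomial probability of counts `(n/2−q, n/2−q, q, q)` under the
probability vector `(π₁, π₁, π₃, π₃)`. -/
noncomputable def multProb (π₁ π₃ : ℝ) (n q : ℕ) : ℝ :=
  (n.factorial : ℝ) / (((n / 2 - q).factorial : ℝ) ^ 2 * (q.factorial : ℝ) ^ 2) *
    π₁ ^ (n - 2 * q) * π₃ ^ (2 * q)

/-- The binomial probability of `q` successes among `m` trials with success probability `p`. -/
noncomputable def binomialMass (p : ℝ) (m q : ℕ) : ℝ :=
  (m.choose q : ℝ) * p ^ q * (1 - p) ^ (m - q)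

/-- The central binomial probability `C(2m, m) / 4 ^ m`. -/
noncomputable def centralMass (m : ℕ) : ℝ :=
  (m.centralBinom : ℝ) / 4 ^ m

lemma centralMass_succ (m : ℕ) :
    centralMass (m + 1) = centralMass m * ((2 * m + 1) / (2 * (m + 1))) := by
  have h : ((m + 1 : ℕ) : ℝ) * (m + 1).centralBinom = 2 * (2 * m + 1) * m.centralBinom := by
    exact_mod_cast Nat.succ_mul_centralBinom_succ m
  push_cast at h
  unfold centralMass
  rw [pow_succ]
  field_simp
  linear_combination 2 * h

lemma centralMass_pos (m : ℕ) : 0 < centralMass m := by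
  have := Nat.centralBinom_pos m
  unfold centralMass
  positivity

lemma centralMass_sq_le (m : ℕ) : (2 * m + 1) * centralMass m ^ 2 ≤ 1 := by
  induction m with
  | zero => simp [centralMass]
  | succ m ih =>
    refine le_trans (le_of_eq_of_le ?_ (mul_le_of_le_one_right
      (b := (2 * m + 1) * (2 * m + 3) / (2 * (m + 1) : ℝ) ^ 2) (by positivity) ?_)) ih
    · rw [centralMass_succ]
      push_cast
      field_simp
      ring
    · rw [div_le_one (by positivity)]
      nlinarith

lemma le_centralMass_sq {m : ℕ} (hm : 1 ≤ m) : 1 ≤ 4 * m * centralMass m ^ 2 := by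
  induction m, hm using Nat.le_induction with
  | base => norm_num [centralMass, Nat.centralBinom, Nat.choose]
  | succ m hm ih =>
    have hm' : (0 : ℝ) < m := by exact_mod_cast hm
    refine ih.trans (le_of_le_of_eq (le_mul_of_one_le_right
      (b := (2 * m + 1) ^ 2 / (4 * m * (m + 1) : ℝ)) (by positivity) ?_) ?_)
    · rw [one_le_div (by positivity)]
      nlinarith
    · rw [centralMass_succ]
      push_cast
      field_simp
      ring

lemma binomialMass_nonneg {p : ℝ} (hp0 : 0 ≤ p) (hp1 : p ≤ 1) (m q : ℕ) :
    0 ≤ binomialMass p m q := by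
  have : 0 ≤ 1 - p := by linarith
  unfold binomialMass
  positivity

lemma sum_binomialMass (p : ℝ) (m : ℕ) :
    ∑ q ∈ Finset.range (m + 1), binomialMass p m q = 1 := by
  have h := add_pow p (1 - p) m
  rw [add_sub_cancel, one_pow] at h
  rw [h]
  exact Finset.sum_congr rfl fun q _ => by unfold binomialMass; ring

lemma binomialMass_le_one {p : ℝ} (hp0 : 0 ≤ p) (hp1 : p ≤ 1) {m q : ℕ} (hq : q ≤ m) :
    binomialMass p m q ≤ 1 := by
  rw [← sum_binomialMass p m]
  exact Finset.single_le_sum (f := binomialMass p m)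
    (fun i _ => binomialMass_nonneg hp0 hp1 m i) (Finset.mem_range.2 (by omega))

lemma multProb_two_mul (π₁ : ℝ) {m q : ℕ} (hq : q ≤ m) :
    multProb π₁ (1 / 2 - π₁) (2 * m) q =
      centralMass m * binomialMass (2 * (1 / 2 - π₁)) m q ^ 2 := by
  obtain ⟨r, rfl⟩ := Nat.exists_eq_add_of_le hq
  have h1 : ((q + r).choose q : ℝ) * q.factorial * r.factorial = (q + r).factorial := by
    have := Nat.choose_mul_factorial_mul_factorial (Nat.le_add_right q r)
    rw [Nat.add_sub_cancel_left] at this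
    exact_mod_cast this
  have h2 : ((q + r).centralBinom : ℝ) * (q + r).factorial * (q + r).factorial =
      (2 * (q + r)).factorial := by
    have := Nat.add_choose_mul_factorial_mul_factorial (q + r) (q + r)
    rw [← two_mul] at this
    exact_mod_cast this
  have h4 : (4 : ℝ) ^ (q + r) = (2 ^ q) ^ 2 * (2 ^ r) ^ 2 := by
    rw [← mul_pow, ← pow_add, pow_right_comm]
    norm_num
  unfold multProb centralMass binomialMass
  rw [← h2, ← h1, h4, show 2 * (q + r) / 2 - q = r by omega, show q + r - q = r by omega,
    show 2 * (q + r) - 2 * q = 2 * r by omega,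
    show 1 - 2 * (1 / 2 - π₁) = 2 * π₁ by ring, mul_pow 2 (1 / 2 - π₁), mul_pow 2 π₁,
    pow_mul' π₁, pow_mul' (1 / 2 - π₁)]
  generalize 1 / 2 - π₁ = x
  have := Nat.factorial_pos q
  have := Nat.factorial_pos r
  field_simp

lemma factorial_le_stirling {n : ℕ} (hn : 1 ≤ n) :
    (n.factorial : ℝ) ≤ Real.exp 1 * √n * (n / Real.exp 1) ^ n := by
  obtain ⟨k, rfl⟩ := Nat.exists_eq_add_of_le' hn
  have h : Stirling.stirlingSeq (k + 1) ≤ Stirling.stirlingSeq 1 :=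
    Stirling.stirlingSeq'_antitone (Nat.zero_le k)
  rw [Stirling.stirlingSeq_one, Stirling.stirlingSeq, div_le_iff₀ (by positivity),
    Real.sqrt_mul (by norm_num)] at h
  refine h.trans (le_of_eq ?_)
  field_simp

lemma stirling_le_factorial (n : ℕ) :
    5 / 2 * √n * (n / Real.exp 1) ^ n ≤ (n.factorial : ℝ) := by
  refine le_trans ?_ (Stirling.le_factorial_stirling n)
  rw [Real.sqrt_mul (by positivity)]
  have : (5 / 2 : ℝ) ≤ √(2 * Real.pi) :=
    Real.le_sqrt_of_sq_le (by linarith [Real.pi_gt_d2])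
  gcongr

lemma binomialMass_mul_factorial (p : ℝ) (q r : ℕ) :
    binomialMass p (q + r) q * (q.factorial * r.factorial) =
      (q + r).factorial * (p ^ q * (1 - p) ^ r) := by
  have h1 : ((q + r).choose q : ℝ) * q.factorial * r.factorial = (q + r).factorial := by
    have := Nat.choose_mul_factorial_mul_factorial (Nat.le_add_right q r)
    rw [Nat.add_sub_cancel_left] at this
    exact_mod_cast this
  rw [← h1, binomialMass, Nat.add_sub_cancel_left]
  ring

lemma pow_div_exp_mul_pow (p : ℝ) {q r : ℕ} (hq : 1 ≤ q) (hr : 1 ≤ r) :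
    (((q + r : ℕ) : ℝ) / Real.exp 1) ^ (q + r) * (p ^ q * (1 - p) ^ r) =
      (p * (q + r) / q) ^ q * ((1 - p) * (q + r) / r) ^ r *
        ((q / Real.exp 1) ^ q * (r / Real.exp 1) ^ r) := by
  have hq' : (0 : ℝ) < q := by exact_mod_cast hq
  have hr' : (0 : ℝ) < r := by exact_mod_cast hr
  rw [pow_add, mul_mul_mul_comm, mul_mul_mul_comm ((p * (q + r) / q) ^ q),
    ← mul_pow, ← mul_pow, ← mul_pow, ← mul_pow]
  push_cast
  congr 2 <;> field_simp

lemma binomialMass_mul_sqrt_le {p : ℝ} (hp0 : 0 < p) (hp1 : p < 1) {q r : ℕ} (hq : 1 ≤ q)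
    (hr : 1 ≤ r) : binomialMass p (q + r) q * (√q * √r) ≤
      √(q + r) * ((p * (q + r) / q) ^ q * ((1 - p) * (q + r) / r) ^ r) := by
  have hq' : (0 : ℝ) < q := by exact_mod_cast hq
  have hr' : (0 : ℝ) < r := by exact_mod_cast hr
  have hp : 0 < 1 - p := by linarith
  have hw := binomialMass_nonneg hp0.le hp1.le (q + r) q
  have he := Real.exp_one_lt_d9
  set G := ((q : ℝ) / Real.exp 1) ^ q * ((r : ℝ) / Real.exp 1) ^ r with hG
  have hG0 : 0 < G := by positivity
  set E := (p * (q + r) / q) ^ q * ((1 - p) * (q + r) / r) ^ r with hE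
  have hE0 : 0 < E := by positivity
  have h : binomialMass p (q + r) q * (25 / 4 * (√q * √r) * G) ≤ 25 / 4 * √(q + r) * E * G := by
    calc _ = binomialMass p (q + r) q * ((5 / 2 * √q * (q / Real.exp 1) ^ q) *
            (5 / 2 * √r * (r / Real.exp 1) ^ r)) := by rw [hG]; ring
      _ ≤ binomialMass p (q + r) q * (q.factorial * r.factorial) := by
          gcongr <;> exact stirling_le_factorial _
      _ = (q + r).factorial * (p ^ q * (1 - p) ^ r) := binomialMass_mul_factorial p q r
      _ ≤ Real.exp 1 * √((q + r : ℕ) : ℝ) * (((q + r : ℕ) : ℝ) / Real.exp 1) ^ (q + r) *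
            (p ^ q * (1 - p) ^ r) := by
          gcongr
          exact factorial_le_stirling (by omega)
      _ = Real.exp 1 * √(q + r) * E * G := by
          rw [mul_assoc, pow_div_exp_mul_pow p hq hr]
          push_cast
          ring
      _ ≤ _ := by gcongr; linarith
  refine le_of_mul_le_mul_right ?_ (show 0 < 25 / 4 * G by positivity)
  linarith

lemma le_binomialMass_mul_sqrt {p : ℝ} (hp0 : 0 < p) (hp1 : p < 1) {q r : ℕ} (hq : 1 ≤ q)
    (hr : 1 ≤ r) : √(q + r) * ((p * (q + r) / q) ^ q * ((1 - p) * (q + r) / r) ^ r) ≤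
      4 * (binomialMass p (q + r) q * (√q * √r)) := by
  have hq' : (0 : ℝ) < q := by exact_mod_cast hq
  have hr' : (0 : ℝ) < r := by exact_mod_cast hr
  have hp : 0 < 1 - p := by linarith
  have hw := binomialMass_nonneg hp0.le hp1.le (q + r) q
  have he := Real.exp_one_lt_d9
  set G := ((q : ℝ) / Real.exp 1) ^ q * ((r : ℝ) / Real.exp 1) ^ r with hG
  have hG0 : 0 < G := by positivity
  set E := (p * (q + r) / q) ^ q * ((1 - p) * (q + r) / r) ^ r with hE
  have hE0 : 0 < E := by positivity
  have h : 5 / 2 * √(q + r) * E * G ≤ 10 * (binomialMass p (q + r) q * (√q * √r) * G) := by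
    calc _ = 5 / 2 * √((q + r : ℕ) : ℝ) * (((q + r : ℕ) : ℝ) / Real.exp 1) ^ (q + r) *
            (p ^ q * (1 - p) ^ r) := by
          rw [mul_assoc _ (_ ^ _), pow_div_exp_mul_pow p hq hr]
          push_cast
          ring
      _ ≤ (q + r).factorial * (p ^ q * (1 - p) ^ r) := by
          gcongr
          exact stirling_le_factorial _
      _ = binomialMass p (q + r) q * (q.factorial * r.factorial) :=
          (binomialMass_mul_factorial p q r).symm
      _ ≤ binomialMass p (q + r) q * ((Real.exp 1 * √q * (q / Real.exp 1) ^ q) *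
            (Real.exp 1 * √r * (r / Real.exp 1) ^ r)) := by
          gcongr <;> exact factorial_le_stirling (by assumption)
      _ = Real.exp 1 ^ 2 * (binomialMass p (q + r) q * (√q * √r) * G) := by rw [hG]; ring
      _ ≤ _ := by
          gcongr
          nlinarith [Real.exp_pos 1]
  refine le_of_mul_le_mul_right ?_ (show 0 < 5 / 2 * G by positivity)
  linarith

lemma pow_le_exp_mul_sub_one {x : ℝ} (hx : 0 ≤ x) (n : ℕ) : x ^ n ≤ Real.exp (n * (x - 1)) := by
  rw [Real.exp_nat_mul]
  have := Real.add_one_le_exp (x - 1)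
  gcongr
  linarith

lemma exp_mul_one_sub_inv_le_pow {x : ℝ} (hx : 0 < x) (n : ℕ) :
    Real.exp (n * (1 - x⁻¹)) ≤ x ^ n := by
  have h := pow_le_exp_mul_sub_one (inv_nonneg.2 hx.le) n
  rw [inv_pow, inv_le_comm₀ (by positivity) (by positivity), ← Real.exp_neg] at h
  rwa [← mul_neg, neg_sub] at h

lemma binomialMass_sq_mul_le {p : ℝ} (hp0 : 0 < p) (hp1 : p < 1) {q r : ℕ} (hq : 1 ≤ q)
    (hr : 1 ≤ r) : binomialMass p (q + r) q ^ 2 * (q * r) ≤ q + r := by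
  have hq' : (0 : ℝ) < q := by exact_mod_cast hq
  have hr' : (0 : ℝ) < r := by exact_mod_cast hr
  have hp : 0 < 1 - p := by linarith
  have hw := binomialMass_nonneg hp0.le hp1.le (q + r) q
  have hE : (p * (q + r) / q) ^ q * ((1 - p) * (q + r) / r) ^ r ≤ 1 := by
    calc _ ≤ Real.exp (q * (p * (q + r) / q - 1)) * Real.exp (r * ((1 - p) * (q + r) / r - 1)) := by
          gcongr <;> exact pow_le_exp_mul_sub_one (by positivity) _
      _ = 1 := by
          rw [← Real.exp_add, Real.exp_eq_one_iff]
          field_simp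
          ring
  have h : binomialMass p (q + r) q * (√q * √r) ≤ √(q + r) :=
    (binomialMass_mul_sqrt_le hp0 hp1 hq hr).trans
      (mul_le_of_le_one_right (Real.sqrt_nonneg _) hE)
  have h2 := pow_le_pow_left₀ (by positivity) h 2
  rwa [mul_pow, mul_pow, Real.sq_sqrt hq'.le, Real.sq_sqrt hr'.le,
    Real.sq_sqrt (by positivity)] at h2

lemma exp_le_binomialMass {p : ℝ} (hp0 : 0 < p) (hp1 : p < 1) {q m : ℕ} (hq : 1 ≤ q)
    (hr : q < m) (hdev : (q - p * m) ^ 2 ≤ m) :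
    Real.exp (-(1 / (p * (1 - p)))) / 4 ≤ binomialMass p m q * √m := by
  obtain ⟨r, rfl⟩ := Nat.exists_eq_add_of_le hr.le
  replace hr : 1 ≤ r := by omega
  have hq' : (0 : ℝ) < q := by exact_mod_cast hq
  have hr' : (0 : ℝ) < r := by exact_mod_cast hr
  have hp : 0 < 1 - p := by linarith
  have hw := binomialMass_nonneg hp0.le hp1.le (q + r) q
  push_cast at hdev ⊢
  have hE : Real.exp (-(1 / (p * (1 - p)))) ≤
      (p * (q + r) / q) ^ q * ((1 - p) * (q + r) / r) ^ r := by
    calc _ ≤ Real.exp (-((q - p * (q + r)) ^ 2 / (p * (1 - p) * (q + r)))) := by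
          rw [Real.exp_le_exp, neg_le_neg_iff, ← div_div, div_right_comm]
          gcongr
          exact (div_le_one (by positivity)).2 hdev
      _ = Real.exp (q * (1 - (p * (q + r) / q)⁻¹)) *
            Real.exp (r * (1 - ((1 - p) * (q + r) / r)⁻¹)) := by
          rw [← Real.exp_add]
          congr 1
          field_simp
          ring
      _ ≤ _ := by
          gcongr <;> exact exp_mul_one_sub_inv_le_pow (by positivity) _
  have hs : √(q : ℝ) * √r ≤ √(q + r) * √(q + r) := by
    gcongr <;> linarith
  have h := le_binomialMass_mul_sqrt hp0 hp1 hq hr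
  have h3 : √((q : ℝ) + r) * Real.exp (-(1 / (p * (1 - p)))) ≤
      √(q + r) * (4 * (binomialMass p (q + r) q * √(q + r))) := by
    calc _ ≤ _ := mul_le_mul_of_nonneg_left hE (Real.sqrt_nonneg _)
      _ ≤ _ := h
      _ ≤ 4 * (binomialMass p (q + r) q * (√(q + r) * √(q + r))) := by gcongr
      _ = _ := by ring
  have := le_of_mul_le_mul_left h3 (by positivity)
  linarith

lemma sum_binomialMass_div_succ_le {p : ℝ} (hp0 : 0 < p) (hp1 : p ≤ 1) (m : ℕ) :
    ∑ q ∈ Finset.range (m + 1), binomialMass p m q / (q + 1) ≤ 1 / (p * (m + 1)) := by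
  have h : ∀ q ∈ Finset.range (m + 1), binomialMass p m q / (q + 1) =
      1 / (p * (m + 1)) * binomialMass p (m + 1) (q + 1) := by
    intro q _
    have hc : ((m : ℝ) + 1) * m.choose q = (m + 1).choose (q + 1) * (q + 1) := by
      exact_mod_cast Nat.add_one_mul_choose_eq m q
    unfold binomialMass
    rw [show m + 1 - (q + 1) = m - q by omega, pow_succ]
    field_simp
    linear_combination (1 - p) ^ (m - q) * hc
  rw [Finset.sum_congr rfl h, ← Finset.mul_sum]
  refine mul_le_of_le_one_right (by positivity) ?_
  have := sum_binomialMass p (m + 1)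
  rw [Finset.sum_range_succ'] at this
  linarith [binomialMass_nonneg hp0.le hp1 (m + 1) 0]

lemma binomialMass_three_mul_sq_le {p : ℝ} (hp0 : 0 < p) (hp1 : p < 1) {k q : ℕ} (hq : q ≤ k) :
    binomialMass p (3 * k) q ^ 2 ≤ 3 / (q + 1) := by
  rcases Nat.eq_zero_or_pos q with rfl | hq0
  · have h0 := binomialMass_nonneg hp0.le hp1.le (3 * k) 0
    have h1 := binomialMass_le_one hp0.le hp1.le (Nat.zero_le (3 * k))
    norm_num
    nlinarith
  · obtain ⟨r, hr⟩ : ∃ r, 3 * k = q + r := ⟨3 * k - q, by omega⟩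
    have h := binomialMass_sq_mul_le hp0 hp1 hq0 (show 1 ≤ r by omega)
    rw [hr, le_div_iff₀ (by positivity)]
    have hq' : (1 : ℝ) ≤ q := by exact_mod_cast hq0
    have hr' : (2 : ℝ) * q ≤ r := by exact_mod_cast (show 2 * q ≤ r by omega)
    have hw := sq_nonneg (binomialMass p (q + r) q)
    set w := binomialMass p (q + r) q ^ 2
    refine le_of_mul_le_mul_right ?_ (show (0 : ℝ) < r by linarith)
    calc w * (q + 1) * r ≤ w * (q + q) * r := by gcongr
      _ = 2 * (w * (q * r)) := by ring
      _ ≤ 2 * (q + r) := by gcongr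
      _ ≤ 3 * r := by linarith

lemma sum_binomialMass_sq_le {p : ℝ} (hp0 : 0 < p) (hp1 : p < 1) {k : ℕ} (hk : 0 < k) :
    ∑ q ∈ Finset.range (k + 1), binomialMass p (3 * k) q ^ 2 ≤
      (1 + 3 / p) / (2 * √((3 * k : ℕ) : ℝ)) := by
  set m := 3 * k with hm
  have hm0 : (0 : ℝ) < m := by exact_mod_cast (show 0 < m by omega)
  have hs : 0 < √(m : ℝ) := by positivity
  have hss : √(m : ℝ) ^ 2 = m := Real.sq_sqrt hm0.le
  set s := √(m : ℝ)
  have hterm : ∀ q ∈ Finset.range (k + 1), binomialMass p m q ^ 2 ≤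
      (1 / (2 * s)) * binomialMass p m q + 3 * s / 2 * (binomialMass p m q / (q + 1)) := by
    intro q hq
    have h := binomialMass_three_mul_sq_le hp0 hp1 (Nat.lt_succ_iff.1 (Finset.mem_range.1 hq))
    rw [← hm] at h
    have hw := binomialMass_nonneg hp0.le hp1.le m q
    set w := binomialMass p m q
    have h1 : w ≤ 1 / (2 * s) + s / 2 * (3 / (q + 1)) := by
      calc w ≤ 1 / (2 * s) + s / 2 * w ^ 2 := by
            rw [← sub_nonneg]
            have : 1 / (2 * s) + s / 2 * w ^ 2 - w = (s * w - 1) ^ 2 / (2 * s) := by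
              field_simp
              ring
            rw [this]
            positivity
        _ ≤ _ := by gcongr
    calc w ^ 2 = w * w := sq w
      _ ≤ w * (1 / (2 * s) + s / 2 * (3 / (q + 1))) := by gcongr
      _ = _ := by ring
  have hsub : Finset.range (k + 1) ⊆ Finset.range (m + 1) := Finset.range_mono (by omega)
  calc _ ≤ ∑ q ∈ Finset.range (k + 1), ((1 / (2 * s)) * binomialMass p m q +
          3 * s / 2 * (binomialMass p m q / (q + 1))) := Finset.sum_le_sum hterm
    _ ≤ ∑ q ∈ Finset.range (m + 1), ((1 / (2 * s)) * binomialMass p m q +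
          3 * s / 2 * (binomialMass p m q / (q + 1))) := by
        refine Finset.sum_le_sum_of_subset_of_nonneg hsub fun q _ _ => ?_
        have := binomialMass_nonneg hp0.le hp1.le m q
        positivity
    _ = 1 / (2 * s) + 3 * s / 2 *
          ∑ q ∈ Finset.range (m + 1), binomialMass p m q / (q + 1) := by
        rw [Finset.sum_add_distrib, ← Finset.mul_sum, ← Finset.mul_sum, sum_binomialMass, mul_one]
    _ ≤ 1 / (2 * s) + 3 * s / 2 * (1 / (p * m)) := by
        gcongr
        refine (sum_binomialMass_div_succ_le hp0 hp1.le m).trans ?_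
        gcongr
        linarith
    _ = _ := by
        rw [← hss]
        field_simp

lemma multProb_nonneg {π₁ π₃ : ℝ} (h1 : 0 ≤ π₁) (h3 : 0 ≤ π₃) (n q : ℕ) :
    0 ≤ multProb π₁ π₃ n q := by
  unfold multProb
  positivity

lemma sum_multProb_le {π₁ : ℝ} (h0 : 0 < π₁) (h1 : π₁ < 1 / 2) {k : ℕ} (hk : 0 < k)
    {S : Finset ℕ} (hS : ∀ q ∈ S, q ≤ k) :
    ∑ q ∈ S, multProb π₁ (1 / 2 - π₁) (6 * k) q ≤
      (1 + 3 / (2 * (1 / 2 - π₁))) / ((6 * k : ℕ) : ℝ) := by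
  have hp0 : 0 < 2 * (1 / 2 - π₁) := by linarith
  have hp1 : 2 * (1 / 2 - π₁) < 1 := by linarith
  have hm0 : (0 : ℝ) < ((3 * k : ℕ) : ℝ) := by exact_mod_cast (show 0 < 3 * k by omega)
  have hc0 := centralMass_pos (3 * k)
  have hc : centralMass (3 * k) ≤ 1 / √((3 * k : ℕ) : ℝ) := by
    rw [le_div_iff₀ (by positivity)]
    refine le_of_sq_le_sq ?_ zero_le_one
    rw [mul_pow, Real.sq_sqrt hm0.le]
    nlinarith [centralMass_sq_le (3 * k), sq_nonneg (centralMass (3 * k))]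
  calc _ ≤ ∑ q ∈ Finset.range (k + 1), multProb π₁ (1 / 2 - π₁) (6 * k) q :=
        Finset.sum_le_sum_of_subset_of_nonneg
          (fun q hq => Finset.mem_range.2 (Nat.lt_succ_iff.2 (hS q hq)))
          fun q _ _ => multProb_nonneg h0.le (by linarith) _ _
    _ = centralMass (3 * k) *
          ∑ q ∈ Finset.range (k + 1), binomialMass (2 * (1 / 2 - π₁)) (3 * k) q ^ 2 := by
        rw [Finset.mul_sum]
        refine Finset.sum_congr rfl fun q hq => ?_
        rw [show 6 * k = 2 * (3 * k) by ring, multProb_two_mul]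
        have := Finset.mem_range.1 hq
        omega
    _ ≤ 1 / √((3 * k : ℕ) : ℝ) *
          ((1 + 3 / (2 * (1 / 2 - π₁))) / (2 * √((3 * k : ℕ) : ℝ))) := by
        gcongr
        exact sum_binomialMass_sq_le hp0 hp1 hk
    _ = (1 + 3 / (2 * (1 / 2 - π₁))) / (2 * √((3 * k : ℕ) : ℝ) ^ 2) := by
        field_simp
    _ = _ := by
        rw [Real.sq_sqrt hm0.le]
        push_cast
        ring

lemma le_sum_multProb {π₁ : ℝ} (h0 : 0 < π₁) (h1 : π₁ < 1 / 2) {k : ℕ} (hk : 0 < k)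
    {S : Finset ℕ} {u : ℕ} (hS : Finset.Ico u (u + Nat.sqrt (3 * k)) ⊆ S) (hu : 1 ≤ u)
    (hk' : u + Nat.sqrt (3 * k) ≤ 3 * k)
    (hdev : ∀ q ∈ Finset.Ico u (u + Nat.sqrt (3 * k)),
      |(q : ℝ) - 2 * (1 / 2 - π₁) * ((3 * k : ℕ) : ℝ)| ≤ Nat.sqrt (3 * k)) :
    (Real.exp (-(1 / (2 * (1 / 2 - π₁) * (1 - 2 * (1 / 2 - π₁))))) / 4) ^ 2 / 2 /
      ((6 * k : ℕ) : ℝ) ≤ ∑ q ∈ S, multProb π₁ (1 / 2 - π₁) (6 * k) q := by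
  have hp0 : 0 < 2 * (1 / 2 - π₁) := by linarith
  have hp1 : 2 * (1 / 2 - π₁) < 1 := by linarith
  set p := 2 * (1 / 2 - π₁) with hp
  set m := 3 * k with hm
  have hm0 : (0 : ℝ) < m := by exact_mod_cast (show 0 < m by omega)
  have hc0 := centralMass_pos m
  set c := Real.exp (-(1 / (p * (1 - p)))) / 4 with hcdef
  have hcpos : 0 < c := by positivity
  have hA : 1 / (2 * √(m : ℝ)) ≤ centralMass m := by
    rw [div_le_iff₀ (by positivity)]
    refine le_of_sq_le_sq ?_ (by positivity)
    have := le_centralMass_sq (show 1 ≤ m by omega)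
    rw [mul_pow, mul_pow, Real.sq_sqrt hm0.le]
    linarith
  have hs1 : √(m : ℝ) / 2 ≤ Nat.sqrt m := by
    have h1 : √(m : ℝ) ≤ Nat.sqrt m + 1 := Real.real_sqrt_le_nat_sqrt_succ
    have h2 : (1 : ℝ) ≤ Nat.sqrt m := by
      exact_mod_cast Nat.sqrt_pos.2 (show 0 < m by omega)
    linarith
  have hs2 : (Nat.sqrt m : ℝ) ^ 2 ≤ m := by exact_mod_cast Nat.sqrt_le' m
  have hterm : ∀ q ∈ Finset.Ico u (u + Nat.sqrt m),
      1 / (2 * √(m : ℝ)) * (c ^ 2 / m) ≤ multProb π₁ (1 / 2 - π₁) (6 * k) q := by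
    intro q hq
    have hq' := Finset.mem_Ico.1 hq
    rw [show 6 * k = 2 * m by omega, multProb_two_mul _ (by omega), ← hp]
    have hb := exp_le_binomialMass hp0 hp1 (q := q) (m := m) (by omega) (by omega)
      ((sq_le_sq.2 ((hdev q hq).trans (le_abs_self _))).trans hs2)
    have hb2 := pow_le_pow_left₀ hcpos.le hb 2
    rw [mul_pow, Real.sq_sqrt hm0.le, ← div_le_iff₀ hm0] at hb2
    gcongr
  calc c ^ 2 / 2 / ((6 * k : ℕ) : ℝ)
      = √(m : ℝ) / 2 * (1 / (2 * √(m : ℝ)) * (c ^ 2 / m)) := by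
        have : ((6 * k : ℕ) : ℝ) = 2 * m := by rw [hm]; push_cast; ring
        rw [this]
        field_simp
    _ ≤ Nat.sqrt m * (1 / (2 * √(m : ℝ)) * (c ^ 2 / m)) := by gcongr
    _ = ∑ q ∈ Finset.Ico u (u + Nat.sqrt m), 1 / (2 * √(m : ℝ)) * (c ^ 2 / m) := by
        simp
    _ ≤ ∑ q ∈ Finset.Ico u (u + Nat.sqrt m), multProb π₁ (1 / 2 - π₁) (6 * k) q :=
        Finset.sum_le_sum hterm
    _ ≤ _ := Finset.sum_le_sum_of_subset_of_nonneg hS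
          fun q _ _ => multProb_nonneg h0.le (by linarith) _ _

lemma sum_binomialMass_le_exp {p : ℝ} (hp0 : 0 ≤ p) (hp1 : p ≤ 1) {m : ℕ} {S : Finset ℕ}
    (hS : S ⊆ Finset.range (m + 1)) {t κ : ℝ} (ht : |t| ≤ 1) (hκ : ∀ q ∈ S, κ ≤ t * q) :
    ∑ q ∈ S, binomialMass p m q ≤ Real.exp (m * (p * t + t ^ 2) - κ) := by
  have hw := binomialMass_nonneg hp0 hp1 m
  have hp : 0 ≤ 1 - p := by linarith
  calc _ ≤ ∑ q ∈ S, binomialMass p m q * Real.exp (t * q - κ) :=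
        Finset.sum_le_sum fun q hq =>
          le_mul_of_one_le_right (hw q) (Real.one_le_exp (by linarith [hκ q hq]))
    _ ≤ ∑ q ∈ Finset.range (m + 1), binomialMass p m q * Real.exp (t * q - κ) :=
        Finset.sum_le_sum_of_subset_of_nonneg hS
          fun q _ _ => mul_nonneg (hw q) (Real.exp_pos _).le
    _ = (p * Real.exp t + (1 - p)) ^ m * Real.exp (-κ) := by
        rw [add_pow, Finset.sum_mul]
        refine Finset.sum_congr rfl fun q _ => ?_
        rw [sub_eq_add_neg, Real.exp_add, mul_comm t, Real.exp_nat_mul, binomialMass, mul_pow]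
        ring
    _ ≤ Real.exp (m * (p * t + t ^ 2)) * Real.exp (-κ) := by
        gcongr
        have h1 := (abs_le.1 (Real.abs_exp_sub_one_sub_id_le ht)).2
        refine (pow_le_exp_mul_sub_one (by positivity) m).trans ?_
        gcongr
        nlinarith [sq_nonneg t]
    _ = _ := by rw [← Real.exp_add, sub_eq_add_neg]

lemma sum_multProb_le_exp {π₁ : ℝ} (h0 : 0 < π₁) (h1 : π₁ < 1 / 2) {k : ℕ}
    {S : Finset ℕ} (hS : ∀ q ∈ S, q ≤ 3 * k) {t κ : ℝ} (ht : |t| ≤ 1)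
    (hκ : ∀ q ∈ S, κ ≤ t * q) :
    ∑ q ∈ S, multProb π₁ (1 / 2 - π₁) (6 * k) q ≤
      Real.exp (3 * k * (2 * (1 / 2 - π₁) * t + t ^ 2) - κ) := by
  have hp0 : 0 ≤ 2 * (1 / 2 - π₁) := by linarith
  have hp1 : 2 * (1 / 2 - π₁) ≤ 1 := by linarith
  have hc0 := centralMass_pos (3 * k)
  have hc : centralMass (3 * k) ≤ 1 := by
    have := centralMass_sq_le (3 * k)
    have hk : (0 : ℝ) ≤ ((3 * k : ℕ) : ℝ) := Nat.cast_nonneg _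
    nlinarith [sq_nonneg (centralMass (3 * k))]
  have h := sum_binomialMass_le_exp hp0 hp1 (m := 3 * k) (S := S)
    (fun q hq => Finset.mem_range.2 (Nat.lt_succ_iff.2 (hS q hq))) ht hκ
  push_cast at h
  refine le_trans (Finset.sum_le_sum fun q hq => ?_) h
  rw [show 6 * k = 2 * (3 * k) by ring, multProb_two_mul _ (hS q hq)]
  have hw := binomialMass_nonneg hp0 hp1 (3 * k) q
  have hw1 := binomialMass_le_one hp0 hp1 (hS q hq)
  calc _ ≤ 1 * binomialMass (2 * (1 / 2 - π₁)) (3 * k) q ^ 2 := by gcongr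
    _ ≤ _ := by nlinarith

lemma exists_sqrt_three_mul_le {ε : ℝ} (hε : 0 < ε) :
    ∃ N : ℕ, ∀ k : ℕ, N < k → (Nat.sqrt (3 * k) : ℝ) + 1 ≤ ε * k := by
  obtain ⟨N, hN⟩ := exists_nat_ge (2 / ε * (1 + 3 / (2 * ε)))
  refine ⟨N, fun k hk => ?_⟩
  have hk' : 2 / ε * (1 + 3 / (2 * ε)) ≤ k := hN.trans (by exact_mod_cast hk.le)
  have hs : (Nat.sqrt (3 * k) : ℝ) ^ 2 ≤ 3 * k := by exact_mod_cast Nat.sqrt_le' (3 * k)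
  set s := (Nat.sqrt (3 * k) : ℝ)
  have h1 : s ≤ ε / 6 * s ^ 2 + 3 / (2 * ε) := by
    rw [← sub_nonneg]
    have : ε / 6 * s ^ 2 + 3 / (2 * ε) - s = (ε * s - 3) ^ 2 / (6 * ε) := by
      field_simp
      ring
    rw [this]
    positivity
  have h2 : 1 + 3 / (2 * ε) ≤ ε / 2 * k := by
    calc 1 + 3 / (2 * ε) = ε / 2 * (2 / ε * (1 + 3 / (2 * ε))) := by field_simp
      _ ≤ _ := by gcongr
  nlinarith

lemma one_le_sqrt_three_mul {k : ℕ} (hk : 0 < k) : 1 ≤ Nat.sqrt (3 * k) :=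
  Nat.sqrt_pos.2 (by omega)

lemma le_sum_multProb_of_below {π₁ : ℝ} (h0 : 1 / 3 ≤ π₁) (h1 : π₁ < 1 / 2) {k : ℕ} (hk : 0 < k)
    {S : Finset ℕ} (hs : (Nat.sqrt (3 * k) : ℝ) + 1 ≤ 6 * (1 / 2 - π₁) * k)
    (hS : ∀ q, q ≤ ⌊(1 / 2 - π₁) * ((6 * k : ℕ) : ℝ)⌋₊ →
      ⌊(1 / 2 - π₁) * ((6 * k : ℕ) : ℝ)⌋₊ < q + Nat.sqrt (3 * k) → q ∈ S) :
    (Real.exp (-(1 / (2 * (1 / 2 - π₁) * (1 - 2 * (1 / 2 - π₁))))) / 4) ^ 2 / 2 /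
      ((6 * k : ℕ) : ℝ) ≤ ∑ q ∈ S, multProb π₁ (1 / 2 - π₁) (6 * k) q := by
  have hx : 0 < 1 / 2 - π₁ := by linarith
  have hy0 : 0 ≤ (1 / 2 - π₁) * ((6 * k : ℕ) : ℝ) := by positivity
  have hf1 := Nat.floor_le hy0
  have hf2 := Nat.lt_floor_add_one ((1 / 2 - π₁) * ((6 * k : ℕ) : ℝ))
  set f := ⌊(1 / 2 - π₁) * ((6 * k : ℕ) : ℝ)⌋₊
  set s := Nat.sqrt (3 * k)
  have hs1 : 1 ≤ s := one_le_sqrt_three_mul hk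
  push_cast at hf1 hf2
  have hsf : s ≤ f := by
    have : (s : ℝ) < f + 1 := by linarith
    exact Nat.lt_succ_iff.1 (by exact_mod_cast this)
  have hfk : f ≤ k := by
    have hk' : (0 : ℝ) < k := by exact_mod_cast hk
    have : (f : ℝ) ≤ k := by nlinarith
    exact_mod_cast this
  have hu : f + 1 - s + s = f + 1 := by omega
  refine le_sum_multProb (by linarith) h1 hk (u := f + 1 - s) ?_ (by omega) (by omega) ?_
  · intro q hq
    have := Finset.mem_Ico.1 hq
    exact hS q (by omega) (by omega)
  · intro q hq
    have := Finset.mem_Ico.1 hq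
    have h2 : (q : ℝ) ≤ f := by exact_mod_cast (show q ≤ f by omega)
    have h3 : (f : ℝ) + 1 ≤ q + s := by exact_mod_cast (show f + 1 ≤ q + s by omega)
    push_cast
    rw [abs_le]
    constructor <;> linarith

lemma le_sum_multProb_of_above {π₁ : ℝ} (h0 : 1 / 3 ≤ π₁) (h1 : π₁ < 1 / 2) {k : ℕ} (hk : 0 < k)
    {S : Finset ℕ} (hs : (Nat.sqrt (3 * k) : ℝ) + 1 ≤ 6 * (1 / 2 - π₁) * k)
    (hs' : (Nat.sqrt (3 * k) : ℝ) + 1 ≤ (1 - 6 * (1 / 2 - π₁)) * k)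
    (hS : ∀ q, ⌊(1 / 2 - π₁) * ((6 * k : ℕ) : ℝ)⌋₊ ≤ q → q ≤ k → q ∈ S) :
    (Real.exp (-(1 / (2 * (1 / 2 - π₁) * (1 - 2 * (1 / 2 - π₁))))) / 4) ^ 2 / 2 /
      ((6 * k : ℕ) : ℝ) ≤ ∑ q ∈ S, multProb π₁ (1 / 2 - π₁) (6 * k) q := by
  have hx : 0 < 1 / 2 - π₁ := by linarith
  have hy0 : 0 ≤ (1 / 2 - π₁) * ((6 * k : ℕ) : ℝ) := by positivity
  have hf1 := Nat.floor_le hy0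
  have hf2 := Nat.lt_floor_add_one ((1 / 2 - π₁) * ((6 * k : ℕ) : ℝ))
  set f := ⌊(1 / 2 - π₁) * ((6 * k : ℕ) : ℝ)⌋₊
  set s := Nat.sqrt (3 * k)
  have hs1 : 1 ≤ s := one_le_sqrt_three_mul hk
  push_cast at hf1 hf2
  have hsf : s ≤ f := by
    have : (s : ℝ) < f + 1 := by linarith
    exact Nat.lt_succ_iff.1 (by exact_mod_cast this)
  have hfk : f + s ≤ k := by
    have : (f : ℝ) + s ≤ k := by linarith
    exact_mod_cast this
  refine le_sum_multProb (by linarith) h1 hk (u := f) ?_ (by omega) (by omega) ?_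
  · intro q hq
    have := Finset.mem_Ico.1 hq
    exact hS q (by omega) (by omega)
  · intro q hq
    have := Finset.mem_Ico.1 hq
    have h2 : (f : ℝ) ≤ q := by exact_mod_cast (show f ≤ q by omega)
    have h3 : (q : ℝ) + 1 ≤ f + s := by exact_mod_cast (show q + 1 ≤ f + s by omega)
    have h4 : (1 : ℝ) ≤ s := by exact_mod_cast hs1
    push_cast
    rw [abs_le]
    constructor <;> linarith

lemma ceil_mul_six_mul_le {b : ℝ} (hb : b ≤ 1 / 6) (k : ℕ) : ⌈b * ((6 * k : ℕ) : ℝ)⌉₊ ≤ k := by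
  rw [Nat.ceil_le]
  push_cast
  nlinarith [(Nat.cast_nonneg k : (0 : ℝ) ≤ k)]

/-- Smoothed-analysis bounds for sums of symmetric multinomial probabilities:
the sums are `Θ(1/n)` when `π₃` lies in the summation region, and exponentially
small otherwise. -/
theorem multinomial_sum_bounds (a b π₁ π₃ : ℝ)
    (ha : a ∈ Set.Ioo (0 : ℝ) (1 / 6)) (hb : b ∈ Set.Ioo (0 : ℝ) (1 / 6))
    (h1 : π₁ ∈ Set.Ico (1 / 3 : ℝ) (1 / 2)) (h3 : π₃ = 1 / 2 - π₁) :
    ((a ≤ π₃ → ∃ c₁ c₂ : ℝ, 0 < c₁ ∧ c₁ ≤ c₂ ∧ ∃ N : ℕ, ∀ n : ℕ, N < n → 6 ∣ n →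
          c₁ / n ≤ ∑ q ∈ Finset.Icc ⌊a * n⌋₊ (n / 6), multProb π₁ π₃ n q ∧
            ∑ q ∈ Finset.Icc ⌊a * n⌋₊ (n / 6), multProb π₁ π₃ n q ≤ c₂ / n) ∧
      (π₃ < a → ∃ C c : ℝ, 0 < C ∧ 0 < c ∧ ∀ n : ℕ, 0 < n → 6 ∣ n →
          ∑ q ∈ Finset.Icc ⌊a * n⌋₊ (n / 6), multProb π₁ π₃ n q ≤
            C * Real.exp (-c * n))) ∧
    ((π₃ ≤ b → ∃ c₁ c₂ : ℝ, 0 < c₁ ∧ c₁ ≤ c₂ ∧ ∃ N : ℕ, ∀ n : ℕ, N < n → 6 ∣ n →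
          c₁ / n ≤ ∑ q ∈ Finset.range (⌈b * n⌉₊ + 1), multProb π₁ π₃ n q ∧
            ∑ q ∈ Finset.range (⌈b * n⌉₊ + 1), multProb π₁ π₃ n q ≤ c₂ / n) ∧
      (b < π₃ → ∃ C c : ℝ, 0 < C ∧ 0 < c ∧ ∀ n : ℕ, 0 < n → 6 ∣ n →
          ∑ q ∈ Finset.range (⌈b * n⌉₊ + 1), multProb π₁ π₃ n q ≤
            C * Real.exp (-c * n))) := by
  subst h3
  obtain ⟨ha0, ha1⟩ := ha
  obtain ⟨hb0, hb1⟩ := hb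
  obtain ⟨h0, h1⟩ := h1
  have hπ : 0 < π₁ := by linarith
  have hx : 0 < 1 / 2 - π₁ := by linarith
  obtain ⟨c₁, hc₁, hc₁pos⟩ : ∃ c₁ : ℝ, c₁ = (Real.exp (-(1 / (2 * (1 / 2 - π₁) *
    (1 - 2 * (1 / 2 - π₁))))) / 4) ^ 2 / 2 ∧ 0 < c₁ := ⟨_, rfl, by positivity⟩
  obtain ⟨c₂, hc₂⟩ : ∃ c₂ : ℝ, c₂ = 1 + 3 / (2 * (1 / 2 - π₁)) := ⟨_, rfl⟩
  have upper : ∀ (k : ℕ), 0 < k → ∀ S : Finset ℕ, (∀ q ∈ S, q ≤ k) →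
      ∑ q ∈ S, multProb π₁ (1 / 2 - π₁) (6 * k) q ≤ max c₁ c₂ / ((6 * k : ℕ) : ℝ) := by
    intro k hk S hS
    refine (sum_multProb_le hπ h1 hk hS).trans ?_
    rw [← hc₂]
    gcongr
    exact le_max_right _ _
  obtain ⟨N₀, hN₀⟩ := exists_sqrt_three_mul_le (show 0 < 6 * (1 / 2 - π₁) by linarith)
  refine ⟨⟨fun hax => ?_, fun hxa => ?_⟩, fun hxb => ?_, fun hbx => ?_⟩
  · refine ⟨c₁, max c₁ c₂, hc₁pos, le_max_left _ _, ?_⟩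
    rcases hax.lt_or_eq with hlt | heq
    · obtain ⟨N₁, hN₁⟩ := exists_sqrt_three_mul_le (show 0 < 6 * (1 / 2 - π₁ - a) by linarith)
      refine ⟨6 * max N₀ N₁, ?_⟩
      rintro n hn ⟨k, rfl⟩
      have hk : max N₀ N₁ < k := by omega
      rw [max_lt_iff] at hk
      rw [Nat.mul_div_cancel_left k (by norm_num)]
      refine ⟨?_, upper k (by omega) _ fun q hq => (Finset.mem_Icc.1 hq).2⟩
      have hs := hN₁ k hk.2
      have hk0 : 0 < k := by omega
      rw [hc₁]
      refine le_sum_multProb_of_below h0 h1 hk0 (hN₀ k hk.1) fun q hq1 hq2 =>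
        Finset.mem_Icc.2 ⟨?_, ?_⟩
      · have hq2' : (⌊(1 / 2 - π₁) * ((6 * k : ℕ) : ℝ)⌋₊ : ℝ) + 1 ≤ q + Nat.sqrt (3 * k) := by
          exact_mod_cast hq2
        have hf := Nat.lt_floor_add_one ((1 / 2 - π₁) * ((6 * k : ℕ) : ℝ))
        refine Nat.floor_le_of_le ?_
        push_cast at hf hq2' ⊢
        linarith
      · refine hq1.trans (Nat.floor_le_of_le ?_)
        push_cast
        nlinarith [(Nat.cast_nonneg k : (0 : ℝ) ≤ k)]
    · obtain ⟨N₁, hN₁⟩ := exists_sqrt_three_mul_le (show 0 < 1 - 6 * (1 / 2 - π₁) by linarith)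
      refine ⟨6 * max N₀ N₁, ?_⟩
      rintro n hn ⟨k, rfl⟩
      have hk : max N₀ N₁ < k := by omega
      rw [max_lt_iff] at hk
      rw [Nat.mul_div_cancel_left k (by norm_num)]
      refine ⟨?_, upper k (by omega) _ fun q hq => (Finset.mem_Icc.1 hq).2⟩
      have hk0 : 0 < k := by omega
      rw [hc₁, heq]
      exact le_sum_multProb_of_above h0 h1 hk0 (hN₀ k hk.1) (hN₁ k hk.2) fun q hq1 hq2 =>
        Finset.mem_Icc.2 ⟨hq1, hq2⟩
  · have ht : 0 < a - (1 / 2 - π₁) := by linarith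
    refine ⟨Real.exp (a - (1 / 2 - π₁)), (a - (1 / 2 - π₁)) ^ 2 / 2, Real.exp_pos _,
      by positivity, ?_⟩
    rintro n - ⟨k, rfl⟩
    rw [Nat.mul_div_cancel_left k (by norm_num)]
    refine (sum_multProb_le_exp hπ h1 (t := a - (1 / 2 - π₁))
      (κ := (a - (1 / 2 - π₁)) * (a * ((6 * k : ℕ) : ℝ) - 1)) (fun q hq => ?_) ?_
      fun q hq => ?_).trans (le_of_eq ?_)
    · have := (Finset.mem_Icc.1 hq).2
      omega
    · rw [abs_le]
      constructor <;> linarith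
    · have hq' : (⌊a * ((6 * k : ℕ) : ℝ)⌋₊ : ℝ) ≤ q := by
        exact_mod_cast (Finset.mem_Icc.1 hq).1
      have hf := Nat.lt_floor_add_one (a * ((6 * k : ℕ) : ℝ))
      gcongr
      linarith
    · rw [← Real.exp_add]
      congr 1
      push_cast
      ring
  · refine ⟨c₁, max c₁ c₂, hc₁pos, le_max_left _ _, 6 * N₀, ?_⟩
    rintro n hn ⟨k, rfl⟩
    have hk : N₀ < k := by omega
    have hk0 : 0 < k := by omega
    refine ⟨?_, upper k hk0 _ fun q hq => ?_⟩
    · rw [hc₁]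
      refine le_sum_multProb_of_below h0 h1 hk0 (hN₀ k hk) fun q hq1 _ =>
        Finset.mem_range.2 (Nat.lt_succ_iff.2 (hq1.trans ?_))
      refine (Nat.floor_le_ceil _).trans (Nat.ceil_mono ?_)
      gcongr
    · exact (Nat.lt_succ_iff.1 (Finset.mem_range.1 hq)).trans (ceil_mul_six_mul_le hb1.le k)
  · have ht : 0 < (1 / 2 - π₁) - b := by linarith
    refine ⟨Real.exp ((1 / 2 - π₁) - b), ((1 / 2 - π₁) - b) ^ 2 / 2, Real.exp_pos _,
      by positivity, ?_⟩
    rintro n - ⟨k, rfl⟩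
    refine (sum_multProb_le_exp hπ h1 (t := b - (1 / 2 - π₁))
      (κ := (b - (1 / 2 - π₁)) * (b * ((6 * k : ℕ) : ℝ) + 1)) (fun q hq => ?_) ?_
      fun q hq => ?_).trans (le_of_eq ?_)
    · have := (Nat.lt_succ_iff.1 (Finset.mem_range.1 hq)).trans (ceil_mul_six_mul_le hb1.le k)
      omega
    · rw [abs_le]
      constructor <;> linarith
    · have hq' : (q : ℝ) ≤ ⌈b * ((6 * k : ℕ) : ℝ)⌉₊ := by
        exact_mod_cast Nat.lt_succ_iff.1 (Finset.mem_range.1 hq)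
      have hf := Nat.ceil_lt_add_one (show 0 ≤ b * ((6 * k : ℕ) : ℝ) by positivity)
      exact mul_le_mul_of_nonpos_left (by linarith) (by linarith)
    · rw [← Real.exp_add]
      congr 1
      push_cast
      ring
end
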